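/- arXiv:1511.09305 — 3 statements merged into one kernel-verified Lean document; each statement's English description precedes it below -/
import Mathlib

section
/- For every δ > 0 there exist Y, U > 0 such that for all pairs (x,y) with 2 ≤ y ≤ x, y ≥ Y and (log x)/(log y) ≥ U, one has |σ̃₂/σ₂ − 1/(1 + y/log x)| ≤ δ. -/
open Complex Finset MeasureTheory
open scoped Real Classical

noncomputable section

/-- The set of primes `p ≤ y`. -/
def primesLe (y : ℝ) : Finset ℕ := (Finset.Iic ⌊y⌋₊).filter Nat.Prime

/-- `α` satisfies the saddle-point equation `∑_{p ≤ y} log p/(p^α − 1) = log x`. -/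
def saddleEq (x y α : ℝ) : Prop :=
  ∑ p ∈ primesLe y, Real.log p / ((p : ℝ) ^ α - 1) = Real.log x

/-- `ū = min{u, π(y)}` where `u = log x/log y`. -/
def ubar (x y : ℝ) : ℝ := min (Real.log x / Real.log y) ((primesLe y).card)

def sigma2 (y α : ℝ) : ℝ :=
  ∑ p ∈ primesLe y, (Real.log p) ^ 2 * (p : ℝ) ^ α / ((p : ℝ) ^ α - 1) ^ 2

def sigma2t (y α : ℝ) : ℝ :=
  ∑ p ∈ primesLe y, (Real.log p) ^ 2 / ((p : ℝ) ^ α - 1) ^ 2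

/-- `ϱ = (1/2)(σ₂ − σ̃₂/3)^{1/2}`. -/
def rhoXY (y α : ℝ) : ℝ := (1 / 2) * Real.sqrt (sigma2 y α - sigma2t y α / 3)

/-- `n` is `y`-friable: every prime factor of `n` is at most `y`. -/
def friable (y : ℝ) (n : ℕ) : Prop := ∀ p : ℕ, p.Prime → p ∣ n → (p : ℝ) ≤ y

/-- `S(x,y)`: the set of `y`-friable integers `1 ≤ n ≤ x`. -/
def Sxy (x y : ℝ) : Finset ℕ := (Finset.Icc 1 ⌊x⌋₊).filter (friable y)

/-- `Ψ(x,y) = #S(x,y)`. -/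
def Psi (x y : ℝ) : ℕ := (Sxy x y).card

/-- `D(x,y;γ) = Ψ(x,y)⁻¹ ∑_{n ∈ S(x,y)} τ(n)⁻¹ #{d ∣ n : d ≥ √n e^γ}`. -/
def Dxy (x y γ : ℝ) : ℝ :=
  (Psi x y : ℝ)⁻¹ * ∑ n ∈ Sxy x y,
    ((n.divisors.card : ℝ))⁻¹ *
      ((n.divisors.filter (fun d => Real.sqrt n * Real.exp γ ≤ (d : ℝ))).card : ℝ)

/-- `Φ(v) = ∫_v^∞ e^{-z²/2} dz/√(2π)`. -/
def PhiGauss (v : ℝ) : ℝ :=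
  ∫ z in Set.Ioi v, Real.exp (-z ^ 2 / 2) / Real.sqrt (2 * Real.pi)

/-- `g(z) = log((z^{1/2} − z^{-1/2})/log z)`, with `g(1) = 0`. -/
def gfun (z : ℂ) : ℂ :=
  if z = 1 then 0
  else Complex.log ((z ^ (2⁻¹ : ℂ) - z ^ (-2⁻¹ : ℂ)) / Complex.log z)

/-- `Ξ(a,b) = −(1/2)log(1−a) − (1/2)log(1−b) − g((1−a)/(1−b))`. -/
def Xi (a b : ℂ) : ℂ :=
  -(2⁻¹ : ℂ) * Complex.log (1 - a) - (2⁻¹ : ℂ) * Complex.log (1 - b) -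
    gfun ((1 - a) / (1 - b))

/-- `f_y(s,w) = ∑_{p ≤ y} Ξ(p^{-s}, p^{-w})`. -/
def fy (y : ℝ) (s w : ℂ) : ℂ := ∑ p ∈ primesLe y, Xi ((p : ℂ) ^ (-s)) ((p : ℂ) ^ (-w))

/-- `F_y(s,w) = exp(f_y(s,w))`. -/
def Fy (y : ℝ) (s w : ℂ) : ℂ := Complex.exp (fy y s w)

/-- `F_y(σ,κ)` at real arguments, as a (positive) real number. -/
def FyR (y σ κ : ℝ) : ℝ := Real.exp ((fy y (σ : ℂ) (κ : ℂ)).re)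

/-- `∂_{kℓ}f(s,w)`: partial derivative `k` times in the first variable and `ℓ` times
in the second. -/
def pdv (k l : ℕ) (f : ℂ → ℂ → ℂ) (s w : ℂ) : ℂ :=
  iteratedDeriv k (fun z => iteratedDeriv l (f z) w) s

/-- `Hess[f_y] = (∂₂₀f_y)(∂₀₂f_y) − (∂₁₁f_y)²`. -/
def HessC (y : ℝ) (s w : ℂ) : ℂ :=
  pdv 2 0 (fy y) s w * pdv 0 2 (fy y) s w - (pdv 1 1 (fy y) s w) ^ 2

/-- The domain `D_δ(α;y)`. -/
def Ddom (δ α y : ℝ) : Set (ℝ × ℝ) :=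
  {p | 0 < p.1 ∧ p.1 ≤ 1 ∧ 0 < p.2 ∧ p.2 ≤ 1 ∧ 0 ≤ (p.1 - α) * (α - p.2) ∧
    1 / (1 + δ) ≤ (1 - (2 : ℝ) ^ (-p.1)) / (1 - (2 : ℝ) ^ (-p.2)) ∧
    (1 - (2 : ℝ) ^ (-p.1)) / (1 - (2 : ℝ) ^ (-p.2)) ≤ 1 + δ ∧
    |p.1 - p.2| * Real.log y ≤ δ}

/-- `φ_k(s,y)`: the `k`-th derivative in `s` of `φ₀(s,y) = −∑_{p ≤ y} log(1−p^{-s})`. -/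
def phiD (y : ℝ) (k : ℕ) (s : ℂ) : ℂ :=
  iteratedDeriv k (fun z => -∑ p ∈ primesLe y, Complex.log (1 - (p : ℂ) ^ (-z))) s

/-- `φ₂(σ,y) = ∑_{p ≤ y} (log p)² p^σ/(p^σ−1)²` for real `σ`. -/
def phi2R (y σ : ℝ) : ℝ :=
  ∑ p ∈ primesLe y, (Real.log p) ^ 2 * (p : ℝ) ^ σ / ((p : ℝ) ^ σ - 1) ^ 2

open Filter Topology

/-- The Fejér kernel is the Fourier transform of the triangle function. -/
lemma integral_triangle_mul_cexp (v : ℝ) :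
    ∫ t in (-1 : ℝ)..1, ((1 - |t| : ℝ) : ℂ) * cexp (t * v * I) = ((Real.sinc (v / 2) ^ 2 : ℝ) : ℂ) := by
  have hcont : Continuous fun t : ℝ => ((1 - |t| : ℝ) : ℂ) * cexp (t * v * I) := by fun_prop
  rw [← intervalIntegral.integral_add_adjacent_intervals (b := 0)
    (hcont.intervalIntegrable _ _) (hcont.intervalIntegrable _ _)]
  have hneg : ∫ t in (-1 : ℝ)..0, ((1 - |t| : ℝ) : ℂ) * cexp (t * v * I)
      = ∫ t in (0 : ℝ)..1, ((1 - t : ℝ) : ℂ) * cexp (t * (-v : ℝ) * I) := by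
    have := intervalIntegral.integral_comp_neg (a := 0) (b := 1)
      (fun t : ℝ => ((1 - |t| : ℝ) : ℂ) * cexp (t * v * I))
    rw [neg_zero] at this
    rw [← this]
    refine intervalIntegral.integral_congr fun t ht => ?_
    rw [Set.uIcc_of_le zero_le_one] at ht
    simp [abs_of_nonneg ht.1]
  have hpos : ∫ t in (0 : ℝ)..1, ((1 - |t| : ℝ) : ℂ) * cexp (t * v * I)
      = ∫ t in (0 : ℝ)..1, ((1 - t : ℝ) : ℂ) * cexp (t * v * I) := by
    refine intervalIntegral.integral_congr fun t ht => ?_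
    rw [Set.uIcc_of_le zero_le_one] at ht
    simp [abs_of_nonneg ht.1]
  rw [hneg, hpos]
  by_cases hv : v = 0
  · subst hv
    simp only [neg_zero, ofReal_zero, mul_zero, zero_mul, Complex.exp_zero, mul_one, zero_div,
      Real.sinc_zero, one_pow, ofReal_one, intervalIntegral.integral_ofReal]
    have : ∫ t in (0 : ℝ)..1, (1 - t) = 1 / 2 := by
      rw [intervalIntegral.integral_sub (by simp) (by simp)]
      simp; norm_num
    rw [this]; push_cast; norm_num
  have half (w : ℝ) (hw : w ≠ 0) : ∫ t in (0 : ℝ)..1, ((1 - t : ℝ) : ℂ) * cexp (t * w * I)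
      = cexp (w * I) / (w * I) ^ 2 - 1 / (w * I) - 1 / (w * I) ^ 2 := by
    have hw' : (w : ℂ) ≠ 0 := by exact_mod_cast hw
    have key (t : ℝ) : HasDerivAt (fun t : ℝ => (1 - t : ℂ) * cexp (t * w * I) / (w * I)
        + cexp (t * w * I) / (w * I) ^ 2) (((1 - t : ℝ) : ℂ) * cexp (t * w * I)) t := by
      have h0 : HasDerivAt (fun t : ℝ => (t : ℂ)) 1 t := Complex.ofRealCLM.hasDerivAt
      have h1 : HasDerivAt (fun t : ℝ => cexp (t * w * I)) (cexp (t * w * I) * (1 * w * I)) t :=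
        ((h0.mul_const (w : ℂ)).mul_const I).cexp
      refine ((((h0.const_sub 1).mul h1).div_const _).add (h1.div_const _)).congr_deriv ?_
      field_simp
      push_cast
      ring
    rw [intervalIntegral.integral_eq_sub_of_hasDerivAt (fun t _ => key t)
      (Continuous.intervalIntegrable (by fun_prop) _ _)]
    simp
    ring
  rw [half v hv, half (-v) (neg_ne_zero.2 hv), Real.sinc_of_ne_zero (by simpa using hv)]
  have hv' : (v : ℂ) ≠ 0 := by exact_mod_cast hv
  have hI : (I : ℂ) ^ 2 = -1 := I_sq
  have e1 : cexp (v * I) = cexp ((v / 2 : ℂ) * I) ^ 2 := by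
    rw [← Complex.exp_nat_mul]; congr 1; push_cast; ring
  have e2 : cexp ((-v : ℝ) * I) = cexp (-(v / 2 : ℂ) * I) ^ 2 := by
    rw [← Complex.exp_nat_mul]; congr 1; push_cast; ring
  have e3 : cexp ((v / 2 : ℂ) * I) * cexp (-(v / 2 : ℂ) * I) = 1 := by
    rw [← Complex.exp_add]; simp
  rw [e1, e2]
  push_cast
  rw [Complex.sin]
  generalize cexp ((v / 2 : ℂ) * I) = a at *
  generalize cexp (-(v / 2 : ℂ) * I) = b at *
  have : (b - a) ^ 2 = a ^ 2 + b ^ 2 - 2 := by linear_combination (-2) * e3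
  simp only [mul_pow, div_pow, this, hI, neg_sq, neg_mul]
  field_simp
  ring

lemma sinc_sq_le (v : ℝ) : Real.sinc v ^ 2 ≤ 2 * (1 + v ^ 2)⁻¹ := by
  have h1 : Real.sinc v ^ 2 ≤ 1 := by
    rw [sq_le_one_iff_abs_le_one]; exact Real.abs_sinc_le_one v
  have h2 : Real.sinc v ^ 2 * v ^ 2 ≤ 1 := by
    by_cases hv : v = 0
    · simp [hv]
    · rw [Real.sinc_of_ne_zero hv, div_pow, div_mul_cancel₀ _ (by positivity)]
      exact Real.sin_sq_le_one v
  rw [← div_eq_mul_inv, le_div_iff₀ (by positivity)]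
  linarith

lemma integrable_sinc_sq : Integrable fun v : ℝ => Real.sinc v ^ 2 := by
  refine (integrable_inv_one_add_sq.const_mul 2).mono'
    (Real.continuous_sinc.pow 2).aestronglyMeasurable (.of_forall fun v => ?_)
  rw [Real.norm_of_nonneg (sq_nonneg _)]
  exact sinc_sq_le v

lemma integral_sinc_sq_pos : 0 < ∫ v : ℝ, Real.sinc v ^ 2 :=
  integral_pos_of_integrable_nonneg_nonzero (x := 0) (Real.continuous_sinc.pow 2)
    integrable_sinc_sq (fun v => sq_nonneg _) (by simp)

/-- Laplace transforms of bounded functions, smoothed against the triangle function. -/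
lemma integral_triangle_mul_laplace {f : ℝ → ℝ} (hf : Measurable f) {C : ℝ} (hC : ∀ u, |f u| ≤ C)
    {G : ℂ → ℂ}
    (hfG : ∀ s : ℂ, 0 < s.re → ∫ u in Set.Ioi (0 : ℝ), (f u : ℂ) * cexp (-s * u) = G s)
    {l T σ : ℝ} (hσ : 0 < σ) :
    ∫ t in (-1 : ℝ)..1, ((1 - |t| : ℝ) : ℂ) * cexp (t * (l * T : ℝ) * I) * G (σ + l * t * I)
      = ∫ u in Set.Ioi (0 : ℝ),
          ((f u * Real.exp (-σ * u) * Real.sinc (l * (T - u) / 2) ^ 2 : ℝ) : ℂ) := by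
  have hre (t : ℝ) : 0 < ((σ : ℂ) + l * t * I).re := by simpa using hσ
  simp_rw [← hfG _ (hre _), ← integral_const_mul]
  rw [intervalIntegral.integral_of_le (by norm_num), integral_integral_swap]
  · refine integral_congr_ae (.of_forall fun u => ?_)
    simp only
    rw [← intervalIntegral.integral_of_le (by norm_num), ofReal_mul (f u * _),
      ← integral_triangle_mul_cexp, ← intervalIntegral.integral_const_mul]
    refine intervalIntegral.integral_congr fun t _ => ?_
    rw [ofReal_mul (f u), ofReal_exp]
    have : cexp (t * (l * T : ℝ) * I) * cexp (-(σ + l * t * I) * u)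
        = cexp ((-σ * u : ℝ)) * cexp (t * (l * (T - u) : ℝ) * I) := by
      rw [← Complex.exp_add, ← Complex.exp_add]
      congr 1; push_cast; ring
    linear_combination ((1 - |t| : ℝ) : ℂ) * f u * this
  · have hbound : Integrable (fun p : ℝ × ℝ => C * Real.exp (-σ * p.2))
        ((volume.restrict (Set.Ioc (-1 : ℝ) 1)).prod (volume.restrict (Set.Ioi 0))) :=
      ((integrableOn_exp_mul_Ioi (neg_lt_zero.2 hσ) 0).const_mul C).comp_snd _
    have hmeas : Measurable (Function.uncurry fun t u : ℝ => ((1 - |t| : ℝ) : ℂ) *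
        cexp (t * (l * T : ℝ) * I) * ((f u : ℂ) * cexp (-(σ + l * t * I) * u))) := by
      unfold Function.uncurry
      have : Measurable fun p : ℝ × ℝ => (f p.2 : ℂ) :=
        Complex.measurable_ofReal.comp (hf.comp measurable_snd)
      refine Measurable.mul ?_ (this.mul ?_)
      · exact Continuous.measurable (by fun_prop)
      · exact Continuous.measurable (by fun_prop)
    refine hbound.mono' hmeas.aestronglyMeasurable ?_
    have : ∀ᵐ p : ℝ × ℝ ∂((volume.restrict (Set.Ioc (-1 : ℝ) 1)).prod
        (volume.restrict (Set.Ioi 0))), p.1 ∈ Set.Ioc (-1 : ℝ) 1 := by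
      exact Measure.quasiMeasurePreserving_fst.ae (ae_restrict_mem measurableSet_Ioc)
    filter_upwards [this] with p hp
    have h1 : |1 - abs p.1| ≤ 1 := by
      have : |p.1| ≤ 1 := abs_le.2 ⟨hp.1.le, hp.2⟩
      rw [abs_of_nonneg (by linarith)]; linarith [abs_nonneg p.1]
    simp only [Function.uncurry, norm_mul, Complex.norm_real, Real.norm_eq_abs, Complex.norm_exp]
    have e1 : ((p.1 : ℂ) * (l * T : ℝ) * I).re = 0 := by simp
    have e2 : (-((σ : ℂ) + l * p.1 * I) * p.2).re = -σ * p.2 := by simp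
    rw [e1, e2, Real.exp_zero, mul_one]
    have := hC p.2
    have h3 := Real.exp_pos (-σ * p.2)
    calc |1 - abs p.1| * (|f p.2| * Real.exp (-σ * p.2))
        ≤ 1 * (|f p.2| * Real.exp (-σ * p.2)) := by gcongr
      _ ≤ _ := by rw [one_mul]; gcongr

/-- The boundary version of `integral_triangle_mul_laplace`. -/
lemma integral_triangle_mul_laplace_boundary {f : ℝ → ℝ} (hf : Measurable f) {C : ℝ}
    (hC : ∀ u, |f u| ≤ C) {G : ℂ → ℂ} (hG : ContinuousOn G {s | 0 ≤ s.re})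
    (hfG : ∀ s : ℂ, 0 < s.re → ∫ u in Set.Ioi (0 : ℝ), (f u : ℂ) * cexp (-s * u) = G s)
    {l : ℝ} (hl : 0 < l) (T : ℝ) :
    ∫ t in (-1 : ℝ)..1, ((1 - |t| : ℝ) : ℂ) * cexp (t * (l * T : ℝ) * I) * G (l * t * I)
      = ∫ u in Set.Ioi (0 : ℝ), ((f u * Real.sinc (l * (T - u) / 2) ^ 2 : ℝ) : ℂ) := by
  have hC0 : 0 ≤ C := (abs_nonneg _).trans (hC 0)
  have hker : Integrable fun u : ℝ => Real.sinc (l * (T - u) / 2) ^ 2 := by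
    have := ((integrable_sinc_sq.comp_mul_left' (R := l / 2) (by positivity)).comp_sub_left T)
    refine this.congr (.of_forall fun u => ?_)
    simp only; congr 2; ring
  have hR : Tendsto (fun σ : ℝ => ∫ u in Set.Ioi (0 : ℝ),
      ((f u * Real.exp (-σ * u) * Real.sinc (l * (T - u) / 2) ^ 2 : ℝ) : ℂ)) (𝓝[>] 0)
      (𝓝 (∫ u in Set.Ioi (0 : ℝ), ((f u * Real.sinc (l * (T - u) / 2) ^ 2 : ℝ) : ℂ))) := by
    refine tendsto_integral_filter_of_dominated_convergence
      (fun u => C * Real.sinc (l * (T - u) / 2) ^ 2) ?_ ?_ (hker.const_mul C).integrableOn ?_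
    · refine .of_forall fun σ => (Complex.measurable_ofReal.comp ?_).aestronglyMeasurable
      refine (hf.mul (Continuous.measurable (by fun_prop))).mul (Continuous.measurable ?_)
      exact (Real.continuous_sinc.comp (by fun_prop)).pow 2
    · filter_upwards [self_mem_nhdsWithin] with σ hσ
      filter_upwards [ae_restrict_mem measurableSet_Ioi] with u hu
      rw [Complex.norm_real, norm_mul, norm_mul, Real.norm_eq_abs (f u), Real.norm_of_nonneg
        (Real.exp_pos _).le, Real.norm_of_nonneg (sq_nonneg _)]
      have : Real.exp (-σ * u) ≤ 1 := by
        rw [Real.exp_le_one_iff]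
        have := mul_pos (show 0 < σ from hσ) (show 0 < u from hu)
        linarith
      have h2 : |f u| * Real.exp (-σ * u) ≤ C * 1 :=
        mul_le_mul (hC u) this (Real.exp_pos _).le hC0
      rw [mul_one] at h2
      gcongr
    · refine .of_forall fun u => (Complex.continuous_ofReal.tendsto _).comp ?_
      have : ContinuousAt (fun σ : ℝ => f u * Real.exp (-σ * u) * Real.sinc (l * (T - u) / 2) ^ 2)
          0 := by fun_prop
      have h := this.tendsto.mono_left (nhdsWithin_le_nhds (s := Set.Ioi 0))
      simpa using h
  have hL : Tendsto (fun σ : ℝ => ∫ t in (-1 : ℝ)..1, ((1 - |t| : ℝ) : ℂ) *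
      cexp (t * (l * T : ℝ) * I) * G (σ + l * t * I)) (𝓝[>] 0)
      (𝓝 (∫ t in (-1 : ℝ)..1, ((1 - |t| : ℝ) : ℂ) * cexp (t * (l * T : ℝ) * I) *
        G (l * t * I))) := by
    have hH : ContinuousOn (fun p : ℝ × ℝ => ((1 - |p.2| : ℝ) : ℂ) *
        cexp (p.2 * (l * T : ℝ) * I) * G (p.1 + l * p.2 * I)) (Set.Icc 0 1 ×ˢ Set.Icc (-1) 1) := by
      refine ContinuousOn.mul (Continuous.continuousOn (by fun_prop)) ?_
      refine hG.comp (Continuous.continuousOn (by fun_prop)) fun p hp => ?_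
      simpa using hp.1.1
    obtain ⟨B, hB⟩ := (isCompact_Icc.prod isCompact_Icc).exists_bound_of_continuousOn hH
    refine intervalIntegral.tendsto_integral_filter_of_dominated_convergence (fun _ => B)
      ?_ ?_ (by simp) ?_
    · filter_upwards [Ioc_mem_nhdsGT (zero_lt_one (α := ℝ))] with σ hσ
      rw [Set.uIoc_of_le (by norm_num)]
      refine ContinuousOn.aestronglyMeasurable ?_ measurableSet_Ioc
      have := hH.comp (f := fun t : ℝ => (σ, t)) (s := Set.Ioc (-1) 1) (by fun_prop)
        fun t ht => ⟨⟨hσ.1.le, hσ.2⟩, Set.Ioc_subset_Icc_self ht⟩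
      exact this
    · filter_upwards [Ioc_mem_nhdsGT (zero_lt_one (α := ℝ))] with σ hσ
      refine .of_forall fun t ht => ?_
      rw [Set.uIoc_of_le (by norm_num)] at ht
      exact hB (σ, t) ⟨⟨hσ.1.le, hσ.2⟩, Set.Ioc_subset_Icc_self ht⟩
    · refine .of_forall fun t _ => Tendsto.const_mul _ ?_
      have h0 : (l * t * I : ℂ) ∈ {s : ℂ | 0 ≤ s.re} := by simp
      refine (hG _ h0).tendsto.comp (tendsto_nhdsWithin_iff.2 ⟨?_, ?_⟩)
      · have : ContinuousAt (fun σ : ℝ => (σ : ℂ) + l * t * I) 0 := by fun_prop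
        have h := this.tendsto.mono_left (nhdsWithin_le_nhds (s := Set.Ioi 0))
        simpa using h
      · filter_upwards [self_mem_nhdsWithin] with σ hσ
        simpa using (show 0 < σ from hσ).le
  refine tendsto_nhds_unique (hL.congr' ?_) hR
  filter_upwards [self_mem_nhdsWithin] with σ hσ
  exact integral_triangle_mul_laplace hf hC hfG hσ

/-- If the Laplace transform of a bounded function extends continuously to the closed right
half-plane, then the Fejér means of the function tend to zero. -/
lemma tendsto_fejer_mean {f : ℝ → ℝ} (hf : Measurable f) {C : ℝ}
    (hC : ∀ u, |f u| ≤ C) {G : ℂ → ℂ} (hG : ContinuousOn G {s | 0 ≤ s.re})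
    (hfG : ∀ s : ℂ, 0 < s.re → ∫ u in Set.Ioi (0 : ℝ), (f u : ℂ) * cexp (-s * u) = G s)
    {l : ℝ} (hl : 0 < l) :
    Tendsto (fun T : ℝ => ∫ u in Set.Ioi (0 : ℝ), f u * Real.sinc (l * (T - u) / 2) ^ 2)
      atTop (𝓝 0) := by
  have key := Real.tendsto_integral_exp_smul_cocompact (E := ℂ)
    ((Set.Ioc (-1 : ℝ) 1).indicator fun t => ((1 - |t| : ℝ) : ℂ) * G (l * t * I))
  have hlim : Tendsto (fun T : ℝ => -(l * T / (2 * π))) atTop (cocompact ℝ) := by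
    refine Tendsto.mono_right (tendsto_neg_atTop_atBot.comp ?_) atBot_le_cocompact
    exact (tendsto_id.const_mul_atTop hl).atTop_div_const (by positivity)
  have h2 := (Complex.continuous_re.tendsto _).comp (key.comp hlim)
  refine (h2.congr fun T => ?_)
  have h3 := integral_triangle_mul_laplace_boundary hf hC hG hfG hl T
  rw [integral_complex_ofReal] at h3
  have h4 := congrArg Complex.re h3
  rw [Complex.ofReal_re] at h4
  rw [← h4, intervalIntegral.integral_of_le (by norm_num), ← integral_indicator measurableSet_Ioc]
  simp only [Function.comp]
  congr 2
  ext t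
  by_cases ht : t ∈ Set.Ioc (-1 : ℝ) 1
  · rw [Set.indicator_of_mem ht, Set.indicator_of_mem ht, Circle.smul_def, Real.fourierChar_apply,
      smul_eq_mul]
    have : (((2 * π * -(t * -(l * T / (2 * π))) : ℝ)) : ℂ) = t * (l * T : ℝ) := by
      rw [← Complex.ofReal_mul]; congr 1; field_simp
    rw [this]; ring
  · rw [Set.indicator_of_notMem ht, Set.indicator_of_notMem ht, smul_zero]

lemma tendsto_sinc_sq_tail :
    Tendsto (fun R : ℝ => ∫ v : ℝ, {v : ℝ | R < |v|}.indicator (fun v => Real.sinc v ^ 2) v)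
      atTop (𝓝 0) := by
  rw [← integral_zero ℝ ℝ]
  refine tendsto_integral_filter_of_dominated_convergence (fun v => Real.sinc v ^ 2) ?_ ?_
    integrable_sinc_sq ?_
  · exact .of_forall fun R => (integrable_sinc_sq.indicator
      (measurableSet_lt measurable_const measurable_abs)).aestronglyMeasurable
  · refine .of_forall fun R => .of_forall fun v => (norm_indicator_le_norm_self _ _).trans ?_
    rw [Real.norm_of_nonneg (sq_nonneg _)]
  · refine .of_forall fun v => tendsto_const_nhds.congr' ?_
    filter_upwards [eventually_ge_atTop |v|] with R hR
    rw [Set.indicator_of_notMem (by simpa using hR)]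

lemma exists_le_fejer_mean {ε C h : ℝ} (hε : 0 < ε) (hC : 0 ≤ C) (hh : 0 < h) :
    ∃ l > 0, ∃ m > 0, ∀ g : ℝ → ℝ, Measurable g → (∀ u, |g u| ≤ C) → ∀ c, h < c →
      (∀ u ∈ Set.Icc (c - h) (c + h), ε ≤ g u) →
      m ≤ ∫ u in Set.Ioi (0 : ℝ), g u * Real.sinc (l * (c - u) / 2) ^ 2 := by
  set J := ∫ v : ℝ, Real.sinc v ^ 2 with hJ
  have hJ0 : 0 < J := integral_sinc_sq_pos
  have hsmall : ∀ᶠ R : ℝ in atTop, (ε + C) *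
      ∫ v : ℝ, {v : ℝ | R < |v|}.indicator (fun v => Real.sinc v ^ 2) v < ε * J / 2 := by
    have := tendsto_sinc_sq_tail.const_mul (ε + C)
    rw [mul_zero] at this
    exact this.eventually_lt_const (by positivity)
  obtain ⟨R, hR, hR0⟩ := (hsmall.and (eventually_gt_atTop 0)).exists
  set τ := ∫ v : ℝ, {v : ℝ | R < |v|}.indicator (fun v => Real.sinc v ^ 2) v with hτ
  have hl : 0 < 2 * R / h := by positivity
  set l := 2 * R / h with hldef
  refine ⟨l, hl, 2 / l * (ε * J / 2), by positivity, fun g hg hgC c hc hge => ?_⟩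
  set H : ℝ → ℝ := fun v => ε * Real.sinc v ^ 2
    - (ε + C) * {v : ℝ | R < |v|}.indicator (fun v => Real.sinc v ^ 2) v with hH
  have hHint : Integrable H := (integrable_sinc_sq.const_mul _).sub
    ((integrable_sinc_sq.indicator
      (measurableSet_lt measurable_const measurable_abs)).const_mul _)
  have hHval : ∫ v, H v = ε * J - (ε + C) * τ := by
    rw [integral_sub (integrable_sinc_sq.const_mul _) ((integrable_sinc_sq.indicator
      (measurableSet_lt measurable_const measurable_abs)).const_mul _), integral_const_mul,
      integral_const_mul]
  have hcomp : ∫ u, H (l / 2 * (c - u)) = 2 / l * (ε * J - (ε + C) * τ) := by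
    rw [integral_sub_left_eq_self (fun u => H (l / 2 * u)) volume c,
      Measure.integral_comp_mul_left, hHval, abs_of_pos (by positivity), inv_div, smul_eq_mul]
  have hcompint : Integrable fun u => H (l / 2 * (c - u)) :=
    (hHint.comp_mul_left' (R := l / 2) (by positivity)).comp_sub_left c
  have hker : Integrable fun u : ℝ => Real.sinc (l * (c - u) / 2) ^ 2 := by
    refine ((integrable_sinc_sq.comp_mul_left' (R := l / 2) (by positivity)).comp_sub_left c).congr
      (.of_forall fun u => ?_)
    simp only; congr 2; ring
  have hgker : Integrable fun u : ℝ => g u * Real.sinc (l * (c - u) / 2) ^ 2 :=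
    hker.bdd_mul hg.aestronglyMeasurable (.of_forall hgC)
  calc 2 / l * (ε * J / 2) ≤ ∫ u, H (l / 2 * (c - u)) := by
        rw [hcomp]; gcongr; linarith
    _ ≤ ∫ u, (Set.Ioi (0 : ℝ)).indicator
          (fun u => g u * Real.sinc (l * (c - u) / 2) ^ 2) u := by
        refine integral_mono hcompint (hgker.indicator measurableSet_Ioi) fun u => ?_
        simp only [hH]
        have e : l / 2 * (c - u) = l * (c - u) / 2 := by ring
        rw [e]
        set k := Real.sinc (l * (c - u) / 2) ^ 2 with hk
        have hk0 : 0 ≤ k := sq_nonneg _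
        by_cases hu : R < |l * (c - u) / 2|
        · rw [Set.indicator_of_mem (by exact hu)]
          by_cases hu0 : u ∈ Set.Ioi (0 : ℝ)
          · rw [Set.indicator_of_mem hu0]
            have := (abs_le.1 (hgC u)).1
            nlinarith
          · rw [Set.indicator_of_notMem hu0]
            nlinarith
        · rw [Set.indicator_of_notMem (by exact hu)]
          have : |c - u| ≤ h := by
            rw [not_lt, abs_div, abs_mul, abs_of_pos hl, abs_of_pos (zero_lt_two (α := ℝ)),
              hldef] at hu
            have h1 : 2 * R / h * |c - u| / 2 = R * (|c - u| / h) := by ring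
            rw [h1] at hu
            have h2 : |c - u| / h ≤ 1 := by
              by_contra! h3
              nlinarith
            rwa [div_le_one hh] at h2
          rw [abs_le] at this
          have hu0 : u ∈ Set.Ioi (0 : ℝ) := by
            have : 0 < u := by linarith
            exact this
          rw [Set.indicator_of_mem hu0]
          have := hge u ⟨by linarith, by linarith⟩
          nlinarith
    _ = _ := integral_indicator measurableSet_Ioi

/-- A Tauberian theorem of Wiener–Ikehara type for bounded, slowly decreasing functions. -/
theorem tendsto_zero_of_laplace_continuousOn {f : ℝ → ℝ} (hf : Measurable f) {C : ℝ}
    (hC : ∀ u, |f u| ≤ C) (hf1 : ∀ u, 0 ≤ f u + 1)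
    (hslow : ∀ u w, u ≤ w → (f u + 1) * Real.exp (u - w) ≤ f w + 1)
    {G : ℂ → ℂ} (hG : ContinuousOn G {s | 0 ≤ s.re})
    (hfG : ∀ s : ℂ, 0 < s.re → ∫ u in Set.Ioi (0 : ℝ), (f u : ℂ) * cexp (-s * u) = G s) :
    Tendsto f atTop (𝓝 0) := by
  have hC0 : 0 ≤ C := (abs_nonneg _).trans (hC 0)
  suffices H : ∀ ε : ℝ, 0 < ε → ε ≤ 1 → ∀ᶠ T in atTop, |f T| < ε by
    rw [Metric.tendsto_nhds]
    intro ε hε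
    filter_upwards [H (min ε 1) (by positivity) (min_le_right _ _)] with T hT
    rw [Real.dist_0_eq_abs]
    exact hT.trans_le (min_le_left _ _)
  intro ε hε hε1
  obtain ⟨h, hh, hexp⟩ : ∃ h > 0, Real.exp (2 * h) = 1 + ε / 2 := by
    refine ⟨Real.log (1 + ε / 2) / 2, ?_, ?_⟩
    · have := Real.log_pos (show 1 < 1 + ε / 2 by linarith)
      positivity
    · rw [mul_div_cancel₀ _ (by norm_num), Real.exp_log (by positivity)]
  obtain ⟨l, hl, m, hm, hmean⟩ := exists_le_fejer_mean (ε := ε / 4) (by positivity) hC0 hh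
  have hlim := tendsto_fejer_mean hf hC hG hfG hl
  have hsm : ∀ᶠ c in atTop,
      |∫ u in Set.Ioi (0 : ℝ), f u * Real.sinc (l * (c - u) / 2) ^ 2| < m := by
    have := (Metric.tendsto_nhds.1 hlim) m hm
    simpa [Real.dist_eq] using this
  have hplus := (tendsto_atTop_add_const_right atTop h tendsto_id).eventually hsm
  have hminus := (tendsto_atTop_add_const_right atTop (-h) tendsto_id).eventually hsm
  filter_upwards [hplus, hminus, eventually_gt_atTop (2 * h)] with T hp hn hT
  simp only [id] at hp hn
  by_contra! hbad
  rcases le_abs'.1 hbad with hneg | hpos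
  · have := hmean (fun u => -f u) hf.neg (fun u => by simpa using hC u) (T + -h) (by linarith)
      fun u hu => by
        have h1 := hslow u T (by linarith [hu.2])
        have h2 : Real.exp (-(2 * h)) ≤ Real.exp (u - T) :=
          Real.exp_le_exp.2 (by linarith [hu.1])
        have h3 : (f u + 1) * Real.exp (-(2 * h)) ≤ 1 - ε :=
          (mul_le_mul_of_nonneg_left h2 (hf1 u)).trans (by linarith)
        rw [Real.exp_neg, ← div_eq_mul_inv, div_le_iff₀ (Real.exp_pos _), hexp] at h3
        nlinarith
    simp only [neg_mul, integral_neg] at this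
    linarith [(abs_lt.1 hn).1]
  · have := hmean f hf hC (T + h) (by linarith) fun u hu => by
        have h1 := hslow T u (by linarith [hu.1])
        have h2 : Real.exp (-(2 * h)) ≤ Real.exp (T - u) :=
          Real.exp_le_exp.2 (by linarith [hu.2])
        have h3 : (1 + ε) * Real.exp (-(2 * h)) ≤ f u + 1 :=
          (mul_le_mul (by linarith) h2 (Real.exp_pos _).le (hf1 T)).trans h1
        rw [Real.exp_neg, ← div_eq_mul_inv, div_le_iff₀ (Real.exp_pos _), hexp] at h3
        nlinarith
    linarith [(abs_lt.1 hp).2]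

/-- The continuous extension of `z ↦ ∫₀^∞ (ψ(eᵘ) e⁻ᵘ - 1) e^(-z u) du` to the closed right
half-plane. -/
def psiLaplace (z : ℂ) : ℂ :=
  (ArithmeticFunction.vonMangoldt.LFunctionResidueClassAux (1 : ZMod 1) (1 + z) - 1) / (1 + z)

lemma continuousOn_psiLaplace : ContinuousOn psiLaplace {z | 0 ≤ z.re} := by
  have hmaps : Set.MapsTo (fun z : ℂ => 1 + z) {z | 0 ≤ z.re} {s | 1 ≤ s.re} := by
    intro z hz
    simpa using hz
  refine ContinuousOn.div (ContinuousOn.sub ?_ continuousOn_const) (by fun_prop) ?_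
  · exact (ArithmeticFunction.vonMangoldt.continuousOn_LFunctionResidueClassAux
      (1 : ZMod 1)).comp (by fun_prop) hmaps
  · intro z hz h
    have h1 : (1 : ℝ) ≤ (1 + z).re := hmaps hz
    rw [h] at h1
    norm_num at h1

lemma integral_Ioi_one_eq_exp (g : ℝ → ℂ) :
    ∫ t in Set.Ioi (1 : ℝ), g t = ∫ u in Set.Ioi (0 : ℝ), Real.exp u * g (Real.exp u) := by
  have himg : Real.exp '' Set.Ioi 0 = Set.Ioi 1 := by
    ext t
    constructor
    · rintro ⟨u, hu, rfl⟩
      exact Real.one_lt_exp_iff.2 hu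
    · intro ht
      have ht' : (1 : ℝ) < t := ht
      exact ⟨Real.log t, Real.log_pos ht', Real.exp_log (by linarith)⟩
  rw [← himg, integral_image_eq_integral_abs_deriv_smul measurableSet_Ioi
    (fun u _ => (Real.hasDerivAt_exp u).hasDerivWithinAt) Real.exp_injective.injOn]
  simp [abs_of_pos (Real.exp_pos _)]

lemma measurable_psi : Measurable Chebyshev.psi := Chebyshev.psi_mono.measurable

lemma psi_exp_mul_exp_neg_le (u : ℝ) :
    Chebyshev.psi (Real.exp u) * Real.exp (-u) ≤ Real.log 4 + 4 := by
  rw [Real.exp_neg, ← div_eq_mul_inv, div_le_iff₀ (Real.exp_pos u)]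
  exact Chebyshev.psi_le_const_mul_self (Real.exp_pos u).le

lemma LSeries_vonMangoldt_eq_psiLaplace {z : ℂ} (hz : 0 < z.re) :
    LSeries (fun n => (ArithmeticFunction.vonMangoldt n : ℂ)) (1 + z)
      = (1 + z) * (psiLaplace z + 1 / z) := by
  have h1 : 1 < (1 + z).re := by simpa using hz
  have h := ArithmeticFunction.vonMangoldt.eqOn_LFunctionResidueClassAux
    (q := 1) (a := 1) isUnit_one h1
  have hres : (fun n => (ArithmeticFunction.vonMangoldt.residueClass (1 : ZMod 1) n : ℂ))
      = fun n => (ArithmeticFunction.vonMangoldt n : ℂ) := by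
    ext n
    have : ArithmeticFunction.vonMangoldt.residueClass (1 : ZMod 1) n
        = ArithmeticFunction.vonMangoldt n :=
      Set.indicator_of_mem (s := {n : ℕ | (n : ZMod 1) = 1}) (Subsingleton.elim _ _) _
    rw [this]
  simp only [hres] at h
  have hz0 : z ≠ 0 := by rintro rfl; simp at hz
  have hz1 : 1 + z ≠ 0 := by
    intro h; rw [h] at h1; norm_num at h1
  rw [psiLaplace, h]
  simp only [Nat.totient_one, Nat.cast_one, inv_one, add_sub_cancel_left]
  field_simp
  ring

lemma LSeries_vonMangoldt_eq_integral {z : ℂ} (hz : 0 < z.re) :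
    LSeries (fun n => (ArithmeticFunction.vonMangoldt n : ℂ)) (1 + z)
      = (1 + z) * ∫ u in Set.Ioi (0 : ℝ),
          ((Chebyshev.psi (Real.exp u) * Real.exp (-u) : ℝ) : ℂ) * cexp (-z * u) := by
  have hpsi (t : ℝ) : ∑ k ∈ Icc 1 ⌊t⌋₊, ArithmeticFunction.vonMangoldt k = Chebyshev.psi t := rfl
  rw [LSeries_eq_mul_integral_of_nonneg (r := 1) _ zero_le_one (by simpa using hz) ?_
    fun n => ArithmeticFunction.vonMangoldt_nonneg]
  · rw [integral_Ioi_one_eq_exp]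
    congr 1
    refine setIntegral_congr_fun measurableSet_Ioi fun u _ => ?_
    rw [← ofReal_sum, hpsi, ofReal_exp, Complex.cpow_def_of_ne_zero (Complex.exp_ne_zero _),
      ← ofReal_exp, ← ofReal_log (Real.exp_pos u).le, Real.log_exp, ofReal_mul, ofReal_exp,
      ofReal_exp]
    have : cexp u * cexp (u * -(1 + z + 1)) = cexp ((-u : ℝ)) * cexp (-z * u) := by
      rw [← Complex.exp_add, ← Complex.exp_add]
      congr 1; push_cast; ring
    linear_combination (Chebyshev.psi (Real.exp u) : ℂ) * this
  · refine Asymptotics.IsBigO.of_bound (Real.log 4 + 4) (.of_forall fun n => ?_)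
    have h1 := hpsi n
    rw [Nat.floor_natCast] at h1
    rw [h1, Real.norm_of_nonneg (Chebyshev.psi_nonneg _), Real.rpow_one,
      Real.norm_of_nonneg (Nat.cast_nonneg n)]
    exact Chebyshev.psi_le_const_mul_self (Nat.cast_nonneg n)

lemma laplace_psi_sub_one {z : ℂ} (hz : 0 < z.re) :
    ∫ u in Set.Ioi (0 : ℝ),
      ((Chebyshev.psi (Real.exp u) * Real.exp (-u) - 1 : ℝ) : ℂ) * cexp (-z * u)
      = psiLaplace z := by
  have hexp : IntegrableOn (fun u : ℝ => cexp (-z * u)) (Set.Ioi 0) :=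
    integrableOn_exp_mul_complex_Ioi (by simpa using hz) 0
  have hmeas : Measurable fun u : ℝ => Chebyshev.psi (Real.exp u) * Real.exp (-u) :=
    (measurable_psi.comp Real.measurable_exp).mul (by fun_prop)
  have hpsi : IntegrableOn (fun u : ℝ =>
      ((Chebyshev.psi (Real.exp u) * Real.exp (-u) : ℝ) : ℂ) * cexp (-z * u)) (Set.Ioi 0) := by
    refine hexp.bdd_mul (c := Real.log 4 + 4)
      (Complex.measurable_ofReal.comp hmeas).aestronglyMeasurable (.of_forall fun u => ?_)
    rw [Complex.norm_real, Real.norm_of_nonneg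
      (mul_nonneg (Chebyshev.psi_nonneg _) (Real.exp_pos _).le)]
    exact psi_exp_mul_exp_neg_le u
  have hz0 : z ≠ 0 := by rintro rfl; simp at hz
  have hz1 : 1 + z ≠ 0 := by
    intro h
    have : (1 + z).re = 0 := by rw [h]; simp
    rw [add_re, one_re] at this
    linarith
  have h1 := (LSeries_vonMangoldt_eq_integral hz).symm.trans (LSeries_vonMangoldt_eq_psiLaplace hz)
  have h2 := mul_left_cancel₀ hz1 h1
  have h3 : ∫ u in Set.Ioi (0 : ℝ), cexp (-z * u) = 1 / z := by
    rw [integral_exp_mul_complex_Ioi (by simpa using hz)]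
    simp
  simp only [ofReal_sub, sub_mul, ofReal_one, one_mul]
  rw [integral_sub hpsi hexp, h2, h3]
  ring

/-- The prime number theorem for the Chebyshev function `ψ`. -/
theorem tendsto_psi_div : Tendsto (fun x : ℝ => Chebyshev.psi x / x) atTop (𝓝 1) := by
  have key : Tendsto (fun u : ℝ => Chebyshev.psi (Real.exp u) * Real.exp (-u) - 1) atTop (𝓝 0) := by
    refine tendsto_zero_of_laplace_continuousOn (C := Real.log 4 + 4 + 1)
      (((measurable_psi.comp Real.measurable_exp).mul (by fun_prop)).sub_const 1)
      (fun u => ?_) (fun u => ?_) (fun u w huw => ?_) continuousOn_psiLaplace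
      fun z hz => laplace_psi_sub_one hz
    · have h1 := psi_exp_mul_exp_neg_le u
      have h2 := mul_nonneg (Chebyshev.psi_nonneg (Real.exp u)) (Real.exp_pos (-u)).le
      have h3 := Real.log_nonneg (show (1 : ℝ) ≤ 4 by norm_num)
      rw [abs_le]
      constructor <;> linarith
    · rw [sub_add_cancel]
      exact mul_nonneg (Chebyshev.psi_nonneg _) (Real.exp_pos _).le
    · rw [sub_add_cancel, sub_add_cancel, mul_assoc, ← Real.exp_add,
        show -u + (u - w) = -w by ring]
      exact mul_le_mul_of_nonneg_right (Chebyshev.psi_mono (Real.exp_le_exp.2 huw))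
        (Real.exp_pos _).le
  have h2 := (key.comp Real.tendsto_log_atTop).add_const 1
  rw [zero_add] at h2
  refine h2.congr' ?_
  filter_upwards [eventually_gt_atTop 0] with x hx
  simp only [Function.comp, sub_add_cancel]
  rw [Real.exp_neg, Real.exp_log hx, div_eq_mul_inv]

/-- The prime number theorem for the Chebyshev function `θ`. -/
theorem tendsto_theta_div : Tendsto (fun x : ℝ => Chebyshev.theta x / x) atTop (𝓝 1) := by
  have h : Tendsto (fun x : ℝ => (Chebyshev.psi x - Chebyshev.theta x) / x) atTop (𝓝 0) := by
    refine (Chebyshev.isBigO_psi_sub_theta_sqrt.trans_isLittleO ?_).tendsto_div_nhds_zero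
    refine (Asymptotics.isLittleO_iff_tendsto' ?_).2 ?_
    · filter_upwards [eventually_ne_atTop 0] with x hx h using absurd h hx
    · refine (tendsto_inv_atTop_zero.comp Real.tendsto_sqrt_atTop).congr fun x => ?_
      exact Real.sqrt_div_self.symm
  have h2 := tendsto_psi_div.sub h
  rw [sub_zero] at h2
  refine h2.congr fun x => ?_
  ring

lemma sum_log_primesLe (y : ℝ) : ∑ p ∈ primesLe y, Real.log p = Chebyshev.theta y := by
  rw [Chebyshev.theta, primesLe]
  refine Finset.sum_congr ?_ fun _ _ => rfl
  ext p
  simp only [mem_filter, Finset.mem_Iic, Finset.mem_Ioc]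
  exact ⟨fun h => ⟨⟨h.2.pos, h.1⟩, h.2⟩, fun h => ⟨h.1.2, h.2⟩⟩

lemma one_lt_of_mem_primesLe {y : ℝ} {p : ℕ} (hp : p ∈ primesLe y) : (1 : ℝ) < p := by
  exact_mod_cast (mem_filter.1 hp).2.one_lt

lemma le_of_mem_primesLe {y : ℝ} {p : ℕ} (hp : p ∈ primesLe y) : (p : ℝ) ≤ y :=
  (Nat.le_floor_iff' (mem_filter.1 hp).2.ne_zero).1 (Finset.mem_Iic.1 (mem_filter.1 hp).1)

lemma log_pos_of_mem_primesLe {y : ℝ} {p : ℕ} (hp : p ∈ primesLe y) : 0 < Real.log p :=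
  Real.log_pos (one_lt_of_mem_primesLe hp)

/-- Bound a sum over primes by treating the primes `p ≤ z` trivially. -/
lemma sum_primesLe_le_add {y z c : ℝ} (hz : 0 ≤ z) (hc : 0 ≤ c) {F G : ℕ → ℝ}
    (hsmall : ∀ p ∈ primesLe y, (p : ℝ) ≤ z → F p ≤ c)
    (hlarge : ∀ p ∈ primesLe y, z < p → F p ≤ G p) (hG : ∀ p ∈ primesLe y, 0 ≤ G p) :
    ∑ p ∈ primesLe y, F p ≤ z * c + ∑ p ∈ primesLe y, G p := by
  have h1 : ∑ p ∈ primesLe y, F p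
      ≤ ∑ p ∈ primesLe y, ((if (p : ℝ) ≤ z then c else 0) + G p) := by
    refine Finset.sum_le_sum fun p hp => ?_
    split_ifs with h
    · linarith [hsmall p hp h, hG p hp]
    · linarith [hlarge p hp (not_le.1 h)]
  have h2 : (((primesLe y).filter fun p : ℕ => (p : ℝ) ≤ z).card : ℝ) ≤ z := by
    have hsub : ((primesLe y).filter fun p : ℕ => (p : ℝ) ≤ z) ⊆ Finset.Icc 1 ⌊z⌋₊ := by
      intro p hp
      have hp' := mem_filter.1 hp
      exact Finset.mem_Icc.2 ⟨(mem_filter.1 hp'.1).2.one_lt.le, Nat.le_floor hp'.2⟩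
    have := Finset.card_le_card hsub
    rw [Nat.card_Icc, Nat.add_sub_cancel] at this
    exact (Nat.cast_le.2 this).trans (Nat.floor_le hz)
  rw [Finset.sum_add_distrib, ← Finset.sum_filter, Finset.sum_const, nsmul_eq_mul] at h1
  linarith [mul_le_mul_of_nonneg_right h2 hc]

lemma mul_log_le_rpow_sub_one {t α : ℝ} (ht : 0 < t) : α * Real.log t ≤ t ^ α - 1 := by
  rw [Real.rpow_def_of_pos ht]
  linarith [Real.add_one_le_exp (Real.log t * α)]

lemma rpow_sub_one_le_mul {t α : ℝ} (ht : 0 < t) : t ^ α - 1 ≤ α * Real.log t * t ^ α := by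
  have h := mul_log_le_rpow_sub_one (α := -α) ht
  have hpos := Real.rpow_pos_of_pos ht α
  rw [Real.rpow_neg ht.le] at h
  have h2 := mul_le_mul_of_nonneg_right h hpos.le
  rw [sub_mul, inv_mul_cancel₀ hpos.ne'] at h2
  linarith

lemma one_lt_rpow_of_mem_primesLe {y α : ℝ} (hα : 0 < α) {p : ℕ} (hp : p ∈ primesLe y) :
    1 < (p : ℝ) ^ α :=
  Real.one_lt_rpow (one_lt_of_mem_primesLe hp) hα

lemma log_div_rpow_sub_one_le {y α : ℝ} (hα : 0 < α) {p : ℕ} (hp : p ∈ primesLe y) :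
    Real.log p / ((p : ℝ) ^ α - 1) ≤ 1 / α := by
  have h1 := one_lt_rpow_of_mem_primesLe hα hp
  rw [div_le_div_iff₀ (by linarith) hα]
  have := mul_log_le_rpow_sub_one (α := α) (zero_lt_one.trans (one_lt_of_mem_primesLe hp))
  linarith

lemma log_sq_div_rpow_sub_one_sq_le {y α : ℝ} (hα : 0 < α) {p : ℕ} (hp : p ∈ primesLe y) :
    Real.log p ^ 2 / ((p : ℝ) ^ α - 1) ^ 2 ≤ 1 / α ^ 2 := by
  have h1 := one_lt_rpow_of_mem_primesLe hα hp
  have h2 : 0 ≤ Real.log p / ((p : ℝ) ^ α - 1) :=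
    div_nonneg (log_pos_of_mem_primesLe hp).le (by linarith)
  have := pow_le_pow_left₀ h2 (log_div_rpow_sub_one_le hα hp) 2
  rwa [div_pow, div_pow, one_pow] at this

/-- Primes `p ≤ z` contribute at most `z / α` to the saddle-point sum. -/
lemma saddle_sum_le {y α z d : ℝ} (hα : 0 < α) (hz : 0 ≤ z) (hd : 0 < d)
    (hlarge : ∀ p ∈ primesLe y, z < p → d ≤ (p : ℝ) ^ α - 1) :
    ∑ p ∈ primesLe y, Real.log p / ((p : ℝ) ^ α - 1) ≤ z * (1 / α) + Chebyshev.theta y / d := by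
  rw [← sum_log_primesLe, Finset.sum_div]
  refine sum_primesLe_le_add hz (by positivity) (fun p hp _ => log_div_rpow_sub_one_le hα hp)
    (fun p hp hzp => ?_) fun p hp => div_nonneg (log_pos_of_mem_primesLe hp).le hd.le
  exact div_le_div_of_nonneg_left (log_pos_of_mem_primesLe hp).le hd (hlarge p hp hzp)

/-- Primes `p ≤ z` contribute at most `z / α ^ 2` to `σ̃₂`. -/
lemma sigma2t_le {y α z d : ℝ} (hα : 0 < α) (hz : 0 ≤ z) (hd : 0 < d)
    (hlarge : ∀ p ∈ primesLe y, z < p → d ≤ (p : ℝ) ^ α) :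
    sigma2t y α ≤ z * (1 / α ^ 2) + sigma2 y α / d := by
  rw [sigma2t, sigma2, Finset.sum_div]
  refine sum_primesLe_le_add hz (by positivity)
    (fun p hp _ => log_sq_div_rpow_sub_one_sq_le hα hp) (fun p hp hzp => ?_) fun p hp => ?_
  · have h1 := one_lt_rpow_of_mem_primesLe hα hp
    rw [le_div_iff₀ hd, mul_div_right_comm]
    exact mul_le_mul_of_nonneg_left (hlarge p hp hzp) (by positivity)
  · have h1 := one_lt_rpow_of_mem_primesLe hα hp
    positivity

lemma sigma2_div_le_sigma2t {y α : ℝ} (hα : 0 < α) :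
    sigma2 y α / y ^ α ≤ sigma2t y α := by
  rw [sigma2t, sigma2, Finset.sum_div]
  refine Finset.sum_le_sum fun p hp => ?_
  have h1 := one_lt_of_mem_primesLe hp
  have h2 := Real.rpow_le_rpow (by linarith) (le_of_mem_primesLe hp) hα.le
  have h3 := one_lt_rpow_of_mem_primesLe hα hp
  rw [div_le_iff₀ (by linarith), mul_div_right_comm]
  exact mul_le_mul_of_nonneg_left h2 (by positivity)

lemma theta_div_le_sigma2 {y α : ℝ} (hy : 1 < y) (hα : 0 < α) :
    Chebyshev.theta y / (Real.log y * α ^ 2 * y ^ α) ≤ sigma2 y α := by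
  rw [sigma2, ← sum_log_primesLe, Finset.sum_div]
  refine Finset.sum_le_sum fun p hp => ?_
  have h1 := one_lt_of_mem_primesLe hp
  have h2 := Real.rpow_le_rpow (by linarith) (le_of_mem_primesLe hp) hα.le
  have h3 := one_lt_rpow_of_mem_primesLe hα hp
  have h4 := rpow_sub_one_le_mul (t := p) (α := α) (by linarith)
  have h5 := Real.log_le_log (by linarith) (le_of_mem_primesLe hp)
  have h6 := log_pos_of_mem_primesLe hp
  have hL := Real.log_pos hy
  set q := (p : ℝ) ^ α
  set B := y ^ α
  have hB : 0 < B := by linarith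
  rw [div_le_div_iff₀ (by positivity) (pow_pos (by linarith) 2)]
  have h7 : (q - 1) ^ 2 ≤ (α * Real.log p * q) ^ 2 := pow_le_pow_left₀ (by linarith) h4 2
  calc Real.log p * (q - 1) ^ 2 ≤ Real.log p * (α * Real.log p * q) ^ 2 := by gcongr
    _ = Real.log p ^ 2 * q * (Real.log p * α ^ 2 * q) := by ring
    _ ≤ Real.log p ^ 2 * q * (Real.log y * α ^ 2 * B) := by gcongr

lemma theta_div_le_saddle_sum {y α : ℝ} (hα : 0 < α) :
    Chebyshev.theta y / (y ^ α - 1)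
      ≤ ∑ p ∈ primesLe y, Real.log p / ((p : ℝ) ^ α - 1) := by
  rw [← sum_log_primesLe, Finset.sum_div]
  refine Finset.sum_le_sum fun p hp => ?_
  have h1 := one_lt_of_mem_primesLe hp
  have h2 := Real.rpow_le_rpow (by linarith) (le_of_mem_primesLe hp) hα.le
  have h3 := one_lt_rpow_of_mem_primesLe hα hp
  exact div_le_div_of_nonneg_left (log_pos_of_mem_primesLe hp).le (by linarith) (by linarith)

lemma log_two_mul_saddle_sum_le_sigma2 {y α : ℝ} (hα : 0 < α) :
    Real.log 2 * ∑ p ∈ primesLe y, Real.log p / ((p : ℝ) ^ α - 1) ≤ sigma2 y α := by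
  rw [sigma2, Finset.mul_sum]
  refine Finset.sum_le_sum fun p hp => ?_
  have h3 := one_lt_rpow_of_mem_primesLe hα hp
  have h6 := log_pos_of_mem_primesLe hp
  have h7 : Real.log 2 ≤ Real.log p :=
    Real.log_le_log (by norm_num) (by exact_mod_cast (mem_filter.1 hp).2.two_le)
  set q := (p : ℝ) ^ α
  have hq : 0 < q - 1 := by linarith
  have h0 := Real.log_pos one_lt_two
  rw [mul_div_assoc', div_le_div_iff₀ hq (by positivity)]
  calc Real.log 2 * Real.log p * (q - 1) ^ 2
      = (Real.log 2 * Real.log p) * (q - 1) * (q - 1) := by ring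
    _ ≤ (Real.log p * Real.log p) * q * (q - 1) := by gcongr; linarith
    _ = _ := by ring

lemma inv_rpow_sub_inv_rpow_le {y α η : ℝ} (hy : 1 < y) (hα : 0 < α) (hη : 0 < η)
    (hη2 : η ≤ 1 / 2) :
    1 / (y ^ (1 - η)) ^ α - 1 / y ^ α ≤ 2 * η := by
  have hy0 : 0 < y := by linarith
  have hL := Real.log_pos hy
  have hD : (y ^ (1 - η)) ^ α = Real.exp ((1 - η) * (α * Real.log y)) := by
    rw [← Real.rpow_mul hy0.le, Real.rpow_def_of_pos hy0]; congr 1; ring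
  have hB : y ^ α = Real.exp (α * Real.log y) := by
    rw [Real.rpow_def_of_pos hy0, mul_comm]
  have ha : 0 < α * Real.log y := by positivity
  rw [hD, hB]
  set a := α * Real.log y
  have h1 : Real.exp a = Real.exp ((1 - η) * a) * Real.exp (η * a) := by
    rw [← Real.exp_add]; congr 1; ring
  have h2 := Real.add_one_le_exp (-(η * a))
  rw [Real.exp_neg] at h2
  have h3 := Real.add_one_le_exp ((1 - η) * a)
  have h4 := Real.exp_pos ((1 - η) * a)
  rw [h1]
  set E := Real.exp ((1 - η) * a)
  have : 1 / E - 1 / (E * Real.exp (η * a)) = (1 - (Real.exp (η * a))⁻¹) / E := by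
    field_simp
  rw [this, div_le_iff₀ h4]
  have h5 : a ≤ 2 * E := by nlinarith
  nlinarith

lemma sigma2_pos {y α : ℝ} (hy : 2 ≤ y) (hα : 0 < α) : 0 < sigma2 y α := by
  refine lt_of_lt_of_le ?_ (theta_div_le_sigma2 (by linarith) hα)
  have := Chebyshev.theta_pos hy
  have := Real.log_pos (show 1 < y by linarith)
  positivity

/-- The estimate in the range of small `α`. -/
lemma abs_sigma2t_div_sub_le_of_small {x y α η ε : ℝ} (hy : 2 ≤ y) (hx : 0 < Real.log x)
    (hα : 0 < α) (hη2 : η ≤ 1 / 2) (hαη : α ≤ η / 2) (hε : 0 < ε) (hε2 : ε ≤ 1 / 2)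
    (hθ : |Chebyshev.theta y - y| ≤ ε * y) (hsm : 2 * Real.log y * y ^ (-(η / 2)) ≤ ε)
    (hs : saddleEq x y α) :
    |sigma2t y α / sigma2 y α - 1 / (1 + y / Real.log x)| ≤ 2 * η + 3 * ε := by
  have hη : 0 < η := by linarith
  have hy0 : 0 < y := by linarith
  have hy1 : 1 < y := by linarith
  have hL := Real.log_pos hy1
  have hσ := sigma2_pos hy hα
  have hDB := inv_rpow_sub_inv_rpow_le hy1 hα hη hη2
  set z := y ^ (1 - η) with hz
  have hz1 : 1 < z := Real.one_lt_rpow hy1 (by linarith)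
  have hB1 : 1 < y ^ α := Real.one_lt_rpow hy1 hα
  have hD1 : 1 < z ^ α := Real.one_lt_rpow hz1 hα
  have hzy : z ≤ y := by
    have := Real.rpow_le_rpow_of_exponent_le hy1.le (show 1 - η ≤ 1 by linarith)
    rwa [Real.rpow_one] at this
  have hDleB : z ^ α ≤ y ^ α := Real.rpow_le_rpow (by linarith) hzy hα.le
  have hlarge : ∀ p ∈ primesLe y, z < p → z ^ α ≤ (p : ℝ) ^ α := fun p _ h =>
    Real.rpow_le_rpow (by linarith) h.le hα.le
  have hsmall : z * y ^ α * (2 * Real.log y) ≤ ε * y := by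
    have h1 : z * y ^ α ≤ y * y ^ (-(η / 2)) := by
      rw [hz, ← Real.rpow_add hy0]
      calc y ^ (1 - η + α) ≤ y ^ (1 + -(η / 2)) :=
            Real.rpow_le_rpow_of_exponent_le hy1.le (by linarith)
        _ = _ := by rw [Real.rpow_add hy0, Real.rpow_one]
    calc z * y ^ α * (2 * Real.log y) ≤ y * y ^ (-(η / 2)) * (2 * Real.log y) := by gcongr
      _ = y * (2 * Real.log y * y ^ (-(η / 2))) := by ring
      _ ≤ y * ε := by gcongr
      _ = _ := mul_comm _ _
  obtain ⟨hθ1, hθ2⟩ := abs_le.1 hθ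
  have hθhalf : y / 2 ≤ Chebyshev.theta y := by nlinarith
  have hrlow : 1 / y ^ α ≤ sigma2t y α / sigma2 y α := by
    rw [div_le_div_iff₀ (by linarith) hσ, one_mul]
    exact (div_le_iff₀ (by linarith)).1 (sigma2_div_le_sigma2t hα)
  have hrup : sigma2t y α / sigma2 y α ≤ 1 / z ^ α + ε := by
    rw [div_le_iff₀ hσ]
    have h1 := sigma2t_le hα (by linarith) (by linarith) hlarge
    have h2 := theta_div_le_sigma2 hy1 hα
    have h3 : z * (1 / α ^ 2) ≤ ε * sigma2 y α := by
      refine le_trans ?_ (mul_le_mul_of_nonneg_left h2 hε.le)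
      rw [mul_one_div, mul_div_assoc', div_le_div_iff₀ (by positivity) (by positivity)]
      have h4 : z * y ^ α * Real.log y ≤ ε * Chebyshev.theta y := by nlinarith
      calc z * (Real.log y * α ^ 2 * y ^ α) = z * y ^ α * Real.log y * α ^ 2 := by ring
        _ ≤ _ := by gcongr
    have h5 : sigma2 y α / z ^ α = 1 / z ^ α * sigma2 y α := by ring
    linarith
  have hs' : ∑ p ∈ primesLe y, Real.log p / ((p : ℝ) ^ α - 1) = Real.log x := hs
  have hvlow := theta_div_le_saddle_sum (y := y) hα
  have hvup := saddle_sum_le (y := y) (d := z ^ α - 1) hα (by linarith) (by linarith)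
    fun p hp h => sub_le_sub_right (hlarge p hp h) 1
  rw [hs'] at hvlow hvup
  set v := Real.log x
  have hg : 1 / (1 + y / v) = v / (v + y) := by field_simp
  have hglow : 1 / y ^ α - ε ≤ v / (v + y) := by
    rw [div_le_iff₀ (by linarith)] at hvlow
    have h1 : (1 - ε) / y ^ α ≤ v / (v + y) := by
      rw [div_le_div_iff₀ (by linarith) (by linarith)]
      nlinarith
    have h2 : ε / y ^ α ≤ ε := div_le_self hε.le hB1.le
    rw [sub_div] at h1
    linarith
  have hgup : v / (v + y) ≤ 1 / z ^ α + 2 * ε := by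
    have hmul := mul_le_mul_of_nonneg_right hvup (show 0 ≤ z ^ α - 1 by linarith)
    rw [add_mul, div_mul_cancel₀ _ (by linarith)] at hmul
    have h1 : z * (1 / α) * (z ^ α - 1) ≤ z * y ^ α * Real.log y := by
      have h2 := rpow_sub_one_le_mul (t := z) (α := α) (by linarith)
      have h3 : Real.log z ≤ Real.log y := Real.log_le_log (by linarith) hzy
      have h0 : 0 ≤ Real.log z := Real.log_nonneg hz1.le
      calc z * (1 / α) * (z ^ α - 1) ≤ z * (1 / α) * (α * Real.log z * z ^ α) := by gcongr
        _ = z * z ^ α * Real.log z := by field_simp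
        _ ≤ _ := by gcongr
    have h2 : v / (v + y) ≤ (1 + 2 * ε) / z ^ α := by
      rw [div_le_div_iff₀ (by linarith) (by linarith)]
      nlinarith
    have h3 : 2 * ε / z ^ α ≤ 2 * ε := div_le_self (by linarith) hD1.le
    rw [add_div] at h2
    linarith
  rw [hg, abs_le]
  constructor <;> linarith

/-- The estimate in the range where `α` is bounded below. -/
lemma abs_sigma2t_div_sub_le_of_large {x y α β ε z : ℝ} (hy : 2 ≤ y) (hx : 0 < Real.log x)
    (hβ : 0 < β) (hαβ : β ≤ α) (hε : 0 < ε) (hz : 0 < z) (hzβ : 1 + 1 / ε ≤ z ^ β)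
    (hθ : Chebyshev.theta y ≤ 2 * y) (hzy : z / β ≤ ε * y)
    (hzx : z / β ^ 2 ≤ ε * (Real.log 2 * Real.log x)) (hs : saddleEq x y α) :
    |sigma2t y α / sigma2 y α - 1 / (1 + y / Real.log x)| ≤ 3 * ε := by
  have hα : 0 < α := by linarith
  have hσ := sigma2_pos hy hα
  have hs' : ∑ p ∈ primesLe y, Real.log p / ((p : ℝ) ^ α - 1) = Real.log x := hs
  have hlarge : ∀ p ∈ primesLe y, z < p → 1 + 1 / ε ≤ (p : ℝ) ^ α := fun p hp h =>
    hzβ.trans ((Real.rpow_le_rpow hz.le h.le hβ.le).trans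
      (Real.rpow_le_rpow_of_exponent_le (one_lt_of_mem_primesLe hp).le hαβ))
  have hvup := saddle_sum_le (y := y) (d := 1 / ε) hα hz.le (by positivity)
    fun p hp h => by linarith [hlarge p hp h]
  have hvσ := log_two_mul_saddle_sum_le_sigma2 (y := y) hα
  have ht := sigma2t_le (y := y) (d := 1 / ε) hα hz.le (by positivity)
    fun p hp h => by linarith [hlarge p hp h]
  rw [hs'] at hvup hvσ
  rw [div_div_eq_mul_div, div_one, mul_one_div] at hvup ht
  have h1 : z / α ≤ z / β := by gcongr
  have h2 : z / α ^ 2 ≤ z / β ^ 2 := by gcongr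
  have hr0 : 0 ≤ sigma2t y α / sigma2 y α :=
    div_nonneg (Finset.sum_nonneg fun p _ => by positivity) hσ.le
  have hr : sigma2t y α / sigma2 y α ≤ 3 * ε := by
    rw [div_le_iff₀ hσ]
    nlinarith
  have hg : 1 / (1 + y / Real.log x) = Real.log x / (Real.log x + y) := by field_simp
  have hg0 : 0 ≤ Real.log x / (Real.log x + y) := by positivity
  have hg3 : Real.log x / (Real.log x + y) ≤ 3 * ε := by
    rw [div_le_iff₀ (by positivity)]
    nlinarith
  rw [hg, abs_le]
  constructor <;> linarith

/-- Lemma 1. As `y, u → ∞`, `σ̃₂/σ₂ = 1/(1 + y/log x) + o(1)`. -/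
theorem stmt3 :
    ∀ δ > (0 : ℝ), ∃ Y > (0 : ℝ), ∃ U > (0 : ℝ), ∀ x y α : ℝ,
      2 ≤ y → y ≤ x → Y ≤ y → U ≤ Real.log x / Real.log y →
      0 < α → saddleEq x y α →
      |sigma2t y α / sigma2 y α - 1 / (1 + y / Real.log x)| ≤ δ := by
  intro δ hδ
  obtain ⟨ε, hε, hε8, hεδ⟩ : ∃ ε > (0 : ℝ), ε ≤ 1 / 8 ∧ ε ≤ δ / 8 :=
    ⟨min (1 / 8) (δ / 8), by positivity, min_le_left _ _, min_le_right _ _⟩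
  set z : ℝ := (1 + 1 / ε) ^ (1 / ε) with hz
  have hz0 : 0 < z := by positivity
  have hzε : 1 + 1 / ε ≤ z ^ ε := by
    rw [hz, ← Real.rpow_mul (by positivity), one_div_mul_cancel hε.ne', Real.rpow_one]
  have hθ : ∀ᶠ y : ℝ in atTop, |Chebyshev.theta y - y| ≤ ε * y := by
    filter_upwards [Metric.tendsto_nhds.1 tendsto_theta_div ε hε, eventually_gt_atTop 0]
      with y hy hy0
    rw [Real.dist_eq, div_sub_one hy0.ne', abs_div, abs_of_pos hy0, div_lt_iff₀ hy0] at hy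
    exact hy.le
  have hsm : ∀ᶠ y : ℝ in atTop, 2 * Real.log y * y ^ (-(2 * ε / 2)) ≤ ε := by
    have h := (isLittleO_log_rpow_atTop hε).tendsto_div_nhds_zero.const_mul 2
    rw [mul_zero] at h
    filter_upwards [h.eventually_le_const hε, eventually_gt_atTop 0] with y hy hy0
    rw [mul_div_cancel_left₀ _ two_ne_zero, Real.rpow_neg hy0.le, mul_assoc, ← div_eq_mul_inv]
    exact hy
  obtain ⟨Y, hY⟩ := eventually_atTop.1
    (hθ.and (hsm.and (eventually_ge_atTop (z / ε / ε))))
  have hlog2 := Real.log_pos one_lt_two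
  refine ⟨max Y 1, by positivity, z / ε ^ 2 / (ε * Real.log 2 * Real.log 2), by positivity,
    fun x y α hy hyx hYy hU hα hs => ?_⟩
  obtain ⟨hθy, hsmy, hzy⟩ := hY y ((le_max_left _ _).trans hYy)
  have hx : 0 < Real.log x := Real.log_pos (by linarith)
  rcases le_total α ε with hαε | hαε
  · refine (abs_sigma2t_div_sub_le_of_small (η := 2 * ε) hy hx hα (by linarith) (by linarith) hε
      (by linarith) hθy hsmy hs).trans (by linarith)
  · refine (abs_sigma2t_div_sub_le_of_large (z := z) hy hx hε hαε hε hz0 hzε ?_ ?_ ?_ hs).trans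
      (by linarith)
    · nlinarith [(abs_le.1 hθy).2]
    · rw [div_le_iff₀ hε] at hzy
      linarith
    · have hlogy : Real.log 2 ≤ Real.log y := Real.log_le_log (by norm_num) hy
      rw [div_le_div_iff₀ (by positivity) (by linarith)] at hU
      have h1 : z / ε ^ 2 * Real.log 2 ≤ z / ε ^ 2 * Real.log y := by gcongr
      refine le_of_mul_le_mul_right (h1.trans (hU.trans_eq ?_)) hlog2
      ring

end
end

section
/- Let (a_n)_{n ≥ 1} be complex numbers and σ₀ > 0 be such that F(s) := ∑_{n ≥ 1} a_n n^{−s} converges absolutely for Re s > σ₀, and let F₀(s) := ∑_{n ≥ 1} |a_n| n^{−s}. There is an absolute constant C > 0 such that for all x ≥ 2, σ > σ₀ and T ≥ 2: |∑_{n ≤ x} a_n − (1/(2πi)) ∫_{σ−iT}^{σ+iT} F(s) x^s ds/s| ≤ C (x^σ/√T) (F₀(σ) + J), where J := ∫_{−√T}^{√T} x^{iτ} F₀(σ+iτ) K(τ/√T) dτ; moreover J is a nonnegative real number. -/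
open Complex Finset MeasureTheory
open scoped Real Classical

noncomputable section

/-- The Fejér-type kernel `K(τ) = max{0, 1 − |τ|}`. -/
def Kker (τ : ℝ) : ℝ := max 0 (1 - |τ|)

/-- The truncated Perron integral `∫_{-T}^{T} e^{(b + it)L} / (b + it) dt`. -/
def perronIntegral (T L b : ℝ) : ℂ :=
  ∫ t in (-T)..T, Complex.exp (((b : ℂ) + t * I) * L) / ((b : ℂ) + t * I)

theorem add_mul_I_ne_zero {b : ℝ} (hb : b ≠ 0) (t : ℝ) : (b : ℂ) + t * I ≠ 0 := by
  intro h
  exact hb (by simpa using congrArg Complex.re h)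

theorem abs_le_norm_add_mul_I (b t : ℝ) : |t| ≤ ‖(b : ℂ) + t * I‖ := by
  simpa using Complex.abs_im_le_norm ((b : ℂ) + t * I)

theorem norm_exp_add_mul_I_mul (b t L : ℝ) :
    ‖Complex.exp (((b : ℂ) + t * I) * L)‖ = Real.exp (b * L) := by
  simp [Complex.norm_exp]

/-- Any function continuous in `t` divided by `b + it` is continuous in `t`. -/
theorem Continuous.div_add_mul_I {f : ℝ → ℂ} (hf : Continuous f) {b : ℝ} (hb : b ≠ 0) :
    Continuous fun t : ℝ => f t / ((b : ℂ) + t * I) :=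
  hf.div (by fun_prop) (add_mul_I_ne_zero hb)

/-- A horizontal side of the contour, at height `±T`. -/
theorem norm_integral_horizontal_le {T L a b : ℝ} (hT : 0 < T) (hL : L ≠ 0) (hab : a ≤ b)
    {h : ℝ} (hh : |h| = T) :
    ‖∫ u in a..b, Complex.exp (((u : ℂ) + h * I) * L) / ((u : ℂ) + h * I)‖ ≤
      (Real.exp (b * L) - Real.exp (a * L)) / (T * L) := by
  have hint : ∫ u in a..b, Real.exp (u * L) / T =
      (Real.exp (b * L) - Real.exp (a * L)) / (T * L) := by
    rw [intervalIntegral.integral_div, intervalIntegral.integral_comp_mul_right _ hL, integral_exp,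
      smul_eq_mul]
    field_simp
  rw [← hint]
  refine intervalIntegral.norm_integral_le_of_norm_le hab (Filter.Eventually.of_forall ?_)
    (Continuous.intervalIntegrable (by fun_prop) _ _)
  intro u _
  rw [norm_div, norm_exp_add_mul_I_mul]
  gcongr
  exact hh ▸ abs_le_norm_add_mul_I u h

/-- Moving the line of integration from `a` to `b`. -/
theorem norm_perronIntegral_sub_le {T L a b : ℝ} (hT : 0 < T) (hL : L ≠ 0) (ha : 0 < a)
    (hab : a ≤ b) :
    ‖perronIntegral T L b - perronIntegral T L a‖ ≤
      2 * ((Real.exp (b * L) - Real.exp (a * L)) / (T * L)) := by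
  have hdiff : DifferentiableOn ℂ (fun s : ℂ => Complex.exp (s * L) / s)
      (Set.uIcc a b ×ℂ Set.uIcc (-T) T) := by
    intro s hs
    have hre : s.re ∈ Set.uIcc a b := (Complex.mem_reProdIm.1 hs).1
    rw [Set.uIcc_of_le hab] at hre
    have hs0 : s ≠ 0 := by
      rintro rfl
      exact absurd (ha.trans_le hre.1) (lt_irrefl 0)
    exact (DifferentiableAt.div (by fun_prop) differentiableAt_id hs0).differentiableWithinAt
  have key := Complex.integral_boundary_rect_eq_zero_of_differentiableOn
    (fun s : ℂ => Complex.exp (s * L) / s) ⟨a, -T⟩ ⟨b, T⟩ hdiff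
  have h1 := norm_integral_horizontal_le hT hL hab (h := T) (abs_of_pos hT)
  have h2 := norm_integral_horizontal_le hT hL hab (h := -T) (by rw [abs_neg, abs_of_pos hT])
  change _ - _ + I • perronIntegral T L b - I • perronIntegral T L a = 0 at key
  set P := perronIntegral T L b
  set Q := perronIntegral T L a
  have hI : ‖P - Q‖ = ‖I • P - I • Q‖ := by rw [← smul_sub, norm_smul]; simp
  rw [hI, show I • P - I • Q =
    (∫ u in a..b, Complex.exp (((u : ℂ) + T * I) * L) / ((u : ℂ) + T * I)) -
      ∫ u in a..b, Complex.exp (((u : ℂ) + (-T : ℝ) * I) * L) / ((u : ℂ) + (-T : ℝ) * I) by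
        linear_combination key]
  exact (norm_sub_le _ _).trans (by linarith)

theorem norm_perronIntegral_le_of_neg {T L b : ℝ} (hT : 0 < T) (hL : L < 0) (hb : 0 < b) :
    ‖perronIntegral T L b‖ ≤ 2 * (Real.exp (b * L) / (T * |L|)) := by
  have hlim : Filter.Tendsto (fun B : ℝ => 2 * (Real.exp (b * L) / (T * |L|)) + 2 * T / B)
      Filter.atTop (nhds (2 * (Real.exp (b * L) / (T * |L|)) + 0)) :=
    tendsto_const_nhds.add (Filter.Tendsto.div_atTop tendsto_const_nhds Filter.tendsto_id)
  rw [add_zero] at hlim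
  refine ge_of_tendsto hlim ?_
  filter_upwards [Filter.eventually_ge_atTop b] with B hB
  have hB0 : 0 < B := hb.trans_le hB
  have h1 := norm_perronIntegral_sub_le hT hL.ne hb hB
  have h2 : ‖perronIntegral T L B‖ ≤ 1 / B * |T - -T| := by
    refine intervalIntegral.norm_integral_le_of_norm_le_const fun t _ => ?_
    rw [norm_div, norm_exp_add_mul_I_mul]
    have h3 : B ≤ ‖(B : ℂ) + t * I‖ := by
      simpa [abs_of_pos hB0] using Complex.abs_re_le_norm ((B : ℂ) + t * I)
    gcongr
    exact Real.exp_le_one_iff.2 (mul_nonpos_of_nonneg_of_nonpos hB0.le hL.le)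
  rw [show |T - -T| = 2 * T by rw [sub_neg_eq_add, ← two_mul, abs_of_pos (by positivity)]] at h2
  have h4 : (Real.exp (B * L) - Real.exp (b * L)) / (T * L) ≤ Real.exp (b * L) / (T * |L|) := by
    rw [abs_of_neg hL, ← neg_div_neg_eq, neg_sub, mul_neg]
    have : 0 < -(T * L) := neg_pos.2 (mul_neg_of_pos_of_neg hT hL)
    gcongr
    linarith [Real.exp_pos (B * L)]
  have h5 : ‖perronIntegral T L b‖ ≤ ‖perronIntegral T L B‖ +
      ‖perronIntegral T L B - perronIntegral T L b‖ := by
    have := norm_sub_le (perronIntegral T L B) (perronIntegral T L B - perronIntegral T L b)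
    simpa using this
  have h6 : 1 / B * (2 * T) = 2 * T / B := by ring
  linarith

theorem integral_inv_add_mul_I {T b : ℝ} (hb : 0 < b) :
    ∫ t in (-T)..T, 1 / ((b : ℂ) + t * I) =
      -I * (Complex.log ((b : ℂ) + T * I) - Complex.log ((b : ℂ) + (-T : ℝ) * I)) := by
  have hd : ∀ t : ℝ, HasDerivAt (fun t : ℝ => -I * Complex.log ((b : ℂ) + t * I))
      (1 / ((b : ℂ) + t * I)) t := by
    intro t
    have h1 : HasDerivAt (fun t : ℝ => (b : ℂ) + t * I) I t := by
      simpa using ((Complex.ofRealCLM.hasDerivAt (x := t)).mul_const I).const_add (b : ℂ)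
    have hs : (b : ℂ) + t * I ∈ Complex.slitPlane := Or.inl (by simpa using hb)
    have h2 := (h1.clog_real hs).const_mul (-I)
    rwa [mul_div_assoc', neg_mul, I_mul_I, neg_neg] at h2
  rw [intervalIntegral.integral_eq_sub_of_hasDerivAt (fun t _ => hd t)
    ((continuous_const.div_add_mul_I hb.ne').intervalIntegrable _ _)]
  ring

theorem norm_integral_inv_add_mul_I_le {T b : ℝ} (hb : 0 < b) :
    ‖∫ t in (-T)..T, 1 / ((b : ℂ) + t * I)‖ ≤ 2 * π := by
  rw [integral_inv_add_mul_I hb, norm_mul, norm_neg, norm_I, one_mul]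
  have hn : ‖(b : ℂ) + T * I‖ = ‖(b : ℂ) + (-T : ℝ) * I‖ := by
    simp only [Complex.norm_add_mul_I, neg_sq]
  have : Complex.log ((b : ℂ) + T * I) - Complex.log ((b : ℂ) + (-T : ℝ) * I) =
      ((Complex.arg ((b : ℂ) + T * I) - Complex.arg ((b : ℂ) + (-T : ℝ) * I) : ℝ) : ℂ) * I := by
    rw [Complex.log, Complex.log, hn]
    push_cast
    ring
  rw [this, norm_mul, norm_I, mul_one, Complex.norm_real, Real.norm_eq_abs]
  refine (abs_sub _ _).trans ?_
  linarith [Complex.abs_arg_le_pi ((b : ℂ) + T * I),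
    Complex.abs_arg_le_pi ((b : ℂ) + (-T : ℝ) * I)]

theorem tendsto_integral_inv_add_mul_I {T : ℝ} (hT : 0 < T) :
    Filter.Tendsto (fun b : ℝ => ∫ t in (-T)..T, 1 / ((b : ℂ) + t * I))
      (nhdsWithin 0 (Set.Ioi 0)) (nhds π) := by
  have hc : ∀ h : ℝ, h ≠ 0 → ContinuousAt (fun b : ℝ => Complex.log ((b : ℂ) + h * I)) 0 := by
    intro h hh
    refine ContinuousAt.clog (by fun_prop) (Or.inr (by simpa using hh))
  have h0 : ContinuousAt (fun b : ℝ => -I * (Complex.log ((b : ℂ) + T * I) -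
      Complex.log ((b : ℂ) + (-T : ℝ) * I))) 0 :=
    ((hc T hT.ne').sub (hc (-T) (neg_ne_zero.2 hT.ne'))).const_mul _
  have hv : -I * (Complex.log (((0 : ℝ) : ℂ) + T * I) -
      Complex.log (((0 : ℝ) : ℂ) + (-T : ℝ) * I)) = π := by
    have e2 : ((-T : ℝ) : ℂ) * I = (T : ℝ) * (-I) := by push_cast; ring
    rw [Complex.ofReal_zero, zero_add, zero_add, e2, Complex.log_ofReal_mul hT I_ne_zero,
      Complex.log_ofReal_mul hT (neg_ne_zero.2 I_ne_zero), Complex.log_I, Complex.log_neg_I]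
    linear_combination -(π : ℂ) * I_mul_I
  have h1 := h0.tendsto
  rw [hv] at h1
  refine (h1.mono_left nhdsWithin_le_nhds).congr' ?_
  filter_upwards [self_mem_nhdsWithin] with b hb
  rw [integral_inv_add_mul_I hb]

theorem norm_exp_sub_one_le_mul_exp (z : ℂ) : ‖Complex.exp z - 1‖ ≤ ‖z‖ * Real.exp ‖z‖ := by
  simpa using Complex.norm_exp_sub_sum_le_norm_mul_exp z 1

theorem norm_exp_mul_sub_one_div_le (s : ℂ) (L : ℝ) :
    ‖(Complex.exp (s * L) - 1) / s‖ ≤ |L| * Real.exp (‖s‖ * |L|) := by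
  rcases eq_or_ne s 0 with rfl | hs
  · simp
  · have h := norm_exp_sub_one_le_mul_exp (s * L)
    rw [norm_mul, Complex.norm_real, Real.norm_eq_abs] at h
    rw [norm_div, div_le_iff₀ (norm_pos_iff.2 hs)]
    linarith

/-- As the line of integration approaches the imaginary axis, the Perron integrals at `L` and `-L`
add up to `2π`. -/
theorem tendsto_perronIntegral_add_neg {T : ℝ} (hT : 0 < T) (L : ℝ) :
    Filter.Tendsto (fun b : ℝ => perronIntegral T L b + perronIntegral T (-L) b)
      (nhdsWithin 0 (Set.Ioi 0)) (nhds (2 * π)) := by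
  set g : ℂ → ℂ := fun s => (Complex.exp (s * L) - 1) / s + (Complex.exp (s * (-L : ℝ)) - 1) / s
    with hg
  have hodd : ∀ s, g (-s) = -g s := by
    intro s
    simp only [hg, Complex.ofReal_neg, neg_mul, mul_neg, neg_neg, div_neg]
    ring
  have hzero : ∫ t in (-T)..T, g (((0 : ℝ) : ℂ) + t * I) = 0 := by
    have h := intervalIntegral.integral_comp_neg (a := -T) (b := T)
      (fun t : ℝ => g (((0 : ℝ) : ℂ) + t * I))
    have h' : ∀ t : ℝ, g (((0 : ℝ) : ℂ) + ((-t : ℝ) : ℂ) * I) = -g (((0 : ℝ) : ℂ) + t * I) := by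
      intro t
      rw [← hodd]
      congr 1
      push_cast
      ring
    simp only [h', intervalIntegral.integral_neg, neg_neg] at h
    exact self_eq_neg.1 h.symm
  have hlim : Filter.Tendsto (fun b : ℝ => ∫ t in (-T)..T, g ((b : ℂ) + t * I))
      (nhdsWithin 0 (Set.Ioi 0)) (nhds 0) := by
    rw [← hzero]
    refine intervalIntegral.tendsto_integral_filter_of_dominated_convergence
      (fun _ => 2 * (|L| * Real.exp ((1 + T) * |L|))) ?_ ?_ intervalIntegrable_const ?_
    · filter_upwards [self_mem_nhdsWithin] with b hb
      refine Continuous.aestronglyMeasurable ?_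
      exact (Continuous.div_add_mul_I (by fun_prop) (ne_of_gt hb)).add
        (Continuous.div_add_mul_I (by fun_prop) (ne_of_gt hb))
    · filter_upwards [Ioo_mem_nhdsGT (zero_lt_one' ℝ)] with b hb
      refine Filter.Eventually.of_forall fun t ht => ?_
      rw [Set.uIoc_of_le (by linarith)] at ht
      have hs : ‖(b : ℂ) + t * I‖ ≤ 1 + T := by
        refine (norm_add_le _ _).trans (add_le_add ?_ ?_)
        · simpa [abs_of_pos hb.1] using hb.2.le
        · simpa using abs_le.2 ⟨ht.1.le, ht.2⟩
      have hbd : ∀ M : ℝ, |M| = |L| →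
          ‖(Complex.exp (((b : ℂ) + t * I) * M) - 1) / ((b : ℂ) + t * I)‖ ≤
            |L| * Real.exp ((1 + T) * |L|) := by
        intro M hM
        refine (norm_exp_mul_sub_one_div_le _ M).trans ?_
        rw [hM]
        gcongr
      exact (norm_add_le _ _).trans (by linarith [hbd L rfl, hbd (-L) (abs_neg L)])
    · have hne : ∀ᵐ t : ℝ, t ≠ 0 := by simp [ae_iff]
      filter_upwards [hne] with t ht _
      have hs : ((0 : ℝ) : ℂ) + t * I ≠ 0 := by simpa using ht
      have hcont : ContinuousAt (fun b : ℝ => g ((b : ℂ) + t * I)) 0 :=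
        ContinuousAt.add (f := fun b : ℝ => (Complex.exp (((b : ℂ) + t * I) * L) - 1) / (b + t * I))
          (ContinuousAt.div (by fun_prop) (by fun_prop) hs)
          (ContinuousAt.div (by fun_prop) (by fun_prop) hs)
      exact hcont.tendsto.mono_left nhdsWithin_le_nhds
  have hsum := hlim.add ((tendsto_integral_inv_add_mul_I hT).const_mul 2)
  rw [zero_add] at hsum
  refine hsum.congr' ?_
  filter_upwards [self_mem_nhdsWithin] with b hb
  have hb' : b ≠ 0 := ne_of_gt hb
  have hi : ∀ {f : ℝ → ℂ}, Continuous f →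
      IntervalIntegrable (fun t : ℝ => f t / ((b : ℂ) + t * I)) volume (-T) T :=
    fun hf => (hf.div_add_mul_I hb').intervalIntegrable _ _
  rw [perronIntegral, perronIntegral, ← intervalIntegral.integral_add (hi (by fun_prop))
    (hi (by fun_prop)), ← intervalIntegral.integral_const_mul, ← intervalIntegral.integral_add
    ((hi (by fun_prop)).add (hi (by fun_prop))) ((hi continuous_const).const_mul 2)]
  refine intervalIntegral.integral_congr fun t _ => ?_
  ring

theorem norm_two_pi_sub_perronIntegral_le_of_pos {T L σ : ℝ} (hT : 0 < T) (hL : 0 < L)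
    (hσ : 0 < σ) :
    ‖2 * π - perronIntegral T L σ‖ ≤ 4 * (Real.exp (σ * L) / (T * |L|)) := by
  have hlim := ((tendsto_perronIntegral_add_neg hT L).const_sub (2 * (π : ℂ))).norm.add_const
    (4 * (Real.exp (σ * L) / (T * |L|)))
  rw [sub_self, norm_zero, zero_add] at hlim
  refine ge_of_tendsto hlim ?_
  filter_upwards [Ioo_mem_nhdsGT hσ] with b hb
  have hTL : 0 < T * L := mul_pos hT hL
  rw [abs_of_pos hL]
  have h1 := norm_perronIntegral_sub_le hT hL.ne' hb.1 hb.2.le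
  have h2 := norm_perronIntegral_le_of_neg hT (neg_neg_of_pos hL) hb.1
  rw [abs_neg, abs_of_pos hL, mul_neg] at h2
  have h3 : (Real.exp (σ * L) - Real.exp (b * L)) / (T * L) + Real.exp (-(b * L)) / (T * L) ≤
      Real.exp (σ * L) / (T * L) := by
    rw [← add_div]
    gcongr
    have : Real.exp (-(b * L)) ≤ Real.exp (b * L) :=
      Real.exp_le_exp.2 (by linarith [mul_pos hb.1 hL])
    linarith
  have h5 : 0 ≤ Real.exp (σ * L) / (T * L) := by positivity
  have h4 : ‖2 * π - perronIntegral T L σ‖ ≤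
      ‖2 * π - (perronIntegral T L b + perronIntegral T (-L) b)‖ +
        ‖perronIntegral T (-L) b‖ + ‖perronIntegral T L σ - perronIntegral T L b‖ := by
    rw [show 2 * (π : ℂ) - perronIntegral T L σ =
      2 * π - (perronIntegral T L b + perronIntegral T (-L) b) + perronIntegral T (-L) b -
        (perronIntegral T L σ - perronIntegral T L b) by ring]
    exact (norm_sub_le _ _).trans (by gcongr; exact norm_add_le _ _)
  linarith

theorem norm_perronIntegral_le {T L σ : ℝ} (hT : 0 < T) (hσ : 0 < σ) :
    ‖perronIntegral T L σ‖ ≤ Real.exp (σ * L) * (2 * π + 2 * (T * |L|)) := by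
  have hi : ∀ {f : ℝ → ℂ}, Continuous f →
      IntervalIntegrable (fun t : ℝ => f t / ((σ : ℂ) + t * I)) volume (-T) T :=
    fun hf => (hf.div_add_mul_I hσ.ne').intervalIntegrable _ _
  have hsplit : perronIntegral T L σ = (Real.exp (σ * L) : ℂ) *
      ((∫ t in (-T)..T, 1 / ((σ : ℂ) + t * I)) +
        ∫ t in (-T)..T, (Complex.exp (I * ((t * L : ℝ) : ℂ)) - 1) / ((σ : ℂ) + t * I)) := by
    rw [← intervalIntegral.integral_add (hi continuous_const) (hi (by fun_prop)),
      ← intervalIntegral.integral_const_mul, perronIntegral]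
    refine intervalIntegral.integral_congr fun t _ => ?_
    rw [show ((σ : ℂ) + t * I) * L = ((σ * L : ℝ) : ℂ) + I * ((t * L : ℝ) : ℂ) by
      push_cast; ring, Complex.exp_add, Complex.ofReal_exp]
    ring
  have h2 : ‖∫ t in (-T)..T, (Complex.exp (I * ((t * L : ℝ) : ℂ)) - 1) / ((σ : ℂ) + t * I)‖ ≤
      |L| * |T - -T| := by
    refine intervalIntegral.norm_integral_le_of_norm_le_const fun t _ => ?_
    rw [norm_div, div_le_iff₀ (norm_pos_iff.2 (add_mul_I_ne_zero hσ.ne' t))]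
    refine Real.norm_exp_I_mul_ofReal_sub_one_le.trans ?_
    rw [Real.norm_eq_abs, abs_mul, mul_comm]
    gcongr
    exact abs_le_norm_add_mul_I σ t
  rw [show |T - -T| = 2 * T by rw [sub_neg_eq_add, ← two_mul, abs_of_pos (by positivity)]] at h2
  rw [hsplit, norm_mul, Complex.norm_real, Real.norm_eq_abs, abs_of_pos (Real.exp_pos _)]
  gcongr
  exact (norm_add_le _ _).trans (by linarith [norm_integral_inv_add_mul_I_le (T := T) hσ])

/-- The error in the truncated Perron formula for a single term. -/
def perronError (T L σ : ℝ) : ℂ :=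
  (if 0 ≤ L then 1 else 0) - 1 / (2 * (π : ℂ)) * perronIntegral T L σ

theorem norm_perronError_le_div {T L σ : ℝ} (hT : 0 < T) (hL : L ≠ 0) (hσ : 0 < σ) :
    ‖perronError T L σ‖ ≤ Real.exp (σ * L) / (T * |L|) := by
  have hπ : (3 : ℝ) < π := Real.pi_gt_three
  have hπ0 : (π : ℂ) ≠ 0 := by exact_mod_cast Real.pi_ne_zero
  have hnn : 0 ≤ Real.exp (σ * L) / (T * |L|) := by positivity
  have hc : ‖1 / (2 * (π : ℂ))‖ = 1 / (2 * π) := by simp [abs_of_pos Real.pi_pos]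
  have aux : ∀ z : ℂ, ‖z‖ ≤ 4 * (Real.exp (σ * L) / (T * |L|)) →
      ‖1 / (2 * (π : ℂ)) * z‖ ≤ Real.exp (σ * L) / (T * |L|) := by
    intro z hz
    rw [norm_mul, hc, one_div, inv_mul_le_iff₀ (by positivity)]
    nlinarith
  rcases lt_or_gt_of_ne hL with h | h
  · rw [perronError, if_neg (not_le.2 h), zero_sub, norm_neg]
    exact aux _ ((norm_perronIntegral_le_of_neg hT h hσ).trans (by linarith))
  · rw [perronError, if_pos h.le, show (1 : ℂ) - 1 / (2 * π) * perronIntegral T L σ =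
      1 / (2 * π) * (2 * π - perronIntegral T L σ) by field_simp]
    exact aux _ (norm_two_pi_sub_perronIntegral_le_of_pos hT h hσ)

theorem norm_perronError_le {T L σ : ℝ} (hT : 0 < T) (hσ : 0 < σ) :
    ‖perronError T L σ‖ ≤ 3 * Real.exp (σ * L) := by
  have hexp := Real.exp_pos (σ * L)
  rcases le_total 1 (T * |L|) with h | h
  · have hL : L ≠ 0 := by
      rintro rfl
      simp at h
      linarith
    refine (norm_perronError_le_div hT hL hσ).trans ((div_le_self hexp.le h).trans ?_)
    linarith
  · have hπ : (3 : ℝ) < π := Real.pi_gt_three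
    have hc : ‖1 / (2 * (π : ℂ))‖ = 1 / (2 * π) := by simp [abs_of_pos Real.pi_pos]
    have h1 : ‖(if 0 ≤ L then 1 else 0 : ℂ)‖ ≤ Real.exp (σ * L) := by
      split_ifs with h0
      · simpa using mul_nonneg hσ.le h0
      · simpa using hexp.le
    have h2 : ‖1 / (2 * (π : ℂ)) * perronIntegral T L σ‖ ≤ 2 * Real.exp (σ * L) := by
      rw [norm_mul, hc, one_div, inv_mul_le_iff₀ (by positivity)]
      refine (norm_perronIntegral_le hT hσ).trans ?_
      nlinarith
    exact (norm_sub_le _ _).trans (by linarith)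

theorem continuous_Kker : Continuous Kker := by
  unfold Kker
  fun_prop

theorem Kker_nonneg (τ : ℝ) : 0 ≤ Kker τ := le_max_left _ _

theorem Kker_le_one (τ : ℝ) : Kker τ ≤ 1 := max_le zero_le_one (by linarith [abs_nonneg τ])

theorem Kker_neg (τ : ℝ) : Kker (-τ) = Kker τ := by rw [Kker, Kker, abs_neg]

theorem Kker_of_mem {τ : ℝ} (h0 : 0 ≤ τ) (h1 : τ ≤ 1) : Kker τ = 1 - τ := by
  rw [Kker, abs_of_nonneg h0, max_eq_right (by linarith)]

/-- The Fejér kernel `∫_{-R}^{R} e^{iτL} K(τ/R) dτ`, as a real integral. -/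
def fejer (R L : ℝ) : ℝ := ∫ τ in (0 : ℝ)..R, 2 * Real.cos (τ * L) * (1 - τ / R)

theorem integral_exp_mul_Kker {R : ℝ} (hR : 0 < R) (L : ℝ) :
    ∫ τ in (-R)..R, Complex.exp (I * τ * L) * (Kker (τ / R) : ℂ) = (fejer R L : ℂ) := by
  have hc : Continuous fun τ : ℝ => Complex.exp (I * τ * L) * (Kker (τ / R) : ℂ) := by
    have := continuous_Kker
    fun_prop
  have hc' : Continuous fun τ : ℝ =>
      Complex.exp (I * ((-τ : ℝ) : ℂ) * L) * (Kker (-τ / R) : ℂ) := hc.comp continuous_neg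
  have hneg := intervalIntegral.integral_comp_neg (a := 0) (b := R)
    (fun τ : ℝ => Complex.exp (I * τ * L) * (Kker (τ / R) : ℂ))
  rw [neg_zero] at hneg
  rw [← intervalIntegral.integral_add_adjacent_intervals (hc.intervalIntegrable (-R) 0)
    (hc.intervalIntegrable 0 R), ← hneg, ← intervalIntegral.integral_add
    (hc'.intervalIntegrable _ _) (hc.intervalIntegrable _ _), fejer,
    ← intervalIntegral.integral_ofReal]
  refine intervalIntegral.integral_congr fun τ hτ => ?_
  rw [Set.uIcc_of_le hR.le] at hτ
  have hK : Kker (τ / R) = 1 - τ / R :=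
    Kker_of_mem (div_nonneg hτ.1 hR.le) ((div_le_one hR).2 hτ.2)
  have h2 := Complex.two_cos ((τ * L : ℝ) : ℂ)
  simp only [neg_div, Kker_neg, hK]
  rw [← add_mul, show I * ((-τ : ℝ) : ℂ) * L = -((τ * L : ℝ) : ℂ) * I by push_cast; ring,
    show I * (τ : ℂ) * L = ((τ * L : ℝ) : ℂ) * I by push_cast; ring, add_comm, ← h2]
  push_cast
  ring

theorem fejer_eq_of_ne_zero {R L : ℝ} (hR : 0 < R) (hL : L ≠ 0) :
    fejer R L = 2 * (1 - Real.cos (R * L)) / (R * L ^ 2) := by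
  have hd : ∀ τ : ℝ, HasDerivAt (fun τ : ℝ => 2 * (Real.sin (τ * L) * (1 - τ / R) / L -
      Real.cos (τ * L) / (R * L ^ 2))) (2 * Real.cos (τ * L) * (1 - τ / R)) τ := by
    intro τ
    have h1 : HasDerivAt (fun τ : ℝ => τ * L) L τ := by simpa using (hasDerivAt_id τ).mul_const L
    have h2 : HasDerivAt (fun τ : ℝ => 1 - τ / R) (-(1 / R)) τ := by
      simpa using ((hasDerivAt_id τ).div_const R).const_sub 1
    refine ((((h1.sin.mul h2).div_const L).sub (h1.cos.div_const (R * L ^ 2))).const_mul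
      2).congr_deriv ?_
    field_simp
    ring
  rw [fejer, intervalIntegral.integral_eq_sub_of_hasDerivAt (fun τ _ => hd τ)
    (Continuous.intervalIntegrable (by fun_prop) _ _)]
  simp only [zero_mul, Real.sin_zero, Real.cos_zero]
  field_simp
  ring

theorem half_le_fejer {R L : ℝ} (hR : 0 < R) (h : R * |L| ≤ 1) : R / 2 ≤ fejer R L := by
  have hhalf : ∫ τ in (0 : ℝ)..R, (1 - τ / R) = R / 2 := by
    rw [intervalIntegral.integral_sub intervalIntegrable_const
      (Continuous.intervalIntegrable (by fun_prop) _ _), intervalIntegral.integral_div,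
      integral_id, intervalIntegral.integral_const, smul_eq_mul]
    field_simp
    ring
  rw [← hhalf]
  refine intervalIntegral.integral_mono_on hR.le (Continuous.intervalIntegrable (by fun_prop) _ _)
    (Continuous.intervalIntegrable (by fun_prop) _ _) fun τ hτ => ?_
  have h1 : |τ * L| ≤ 1 := by
    rw [abs_mul, abs_of_nonneg hτ.1]
    exact (mul_le_mul_of_nonneg_right hτ.2 (abs_nonneg L)).trans h
  have h2 : (τ * L) ^ 2 ≤ 1 := (sq_le_one_iff_abs_le_one _).2 h1
  have h3 := Real.one_sub_sq_div_two_le_cos (x := τ * L)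
  have h4 : 0 ≤ 1 - τ / R := sub_nonneg.2 ((div_le_one hR).2 hτ.2)
  exact le_mul_of_one_le_left h4 (by linarith)

theorem fejer_nonneg {R : ℝ} (hR : 0 < R) (L : ℝ) : 0 ≤ fejer R L := by
  rcases eq_or_ne L 0 with rfl | hL
  · exact (half_pos hR).le.trans (half_le_fejer hR (by simp))
  · rw [fejer_eq_of_ne_zero hR hL]
    have := Real.cos_le_one (R * L)
    have : 0 ≤ 1 - Real.cos (R * L) := by linarith
    positivity

theorem norm_perronError_le_fejer {T σ : ℝ} (hT : 0 < T) (hσ : 0 < σ) (L : ℝ) :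
    ‖perronError T L σ‖ ≤
      6 * (Real.exp (σ * L) / Real.sqrt T) * (1 + fejer (Real.sqrt T) L) := by
  have hR : 0 < Real.sqrt T := Real.sqrt_pos.2 hT
  have hW := fejer_nonneg hR L
  have hq : 0 < Real.exp (σ * L) / Real.sqrt T := by positivity
  rcases le_total 1 (Real.sqrt T * |L|) with h | h
  · have hL : L ≠ 0 := by
      rintro rfl
      simp at h
      linarith
    have h1 : Real.sqrt T ≤ T * |L| := by
      calc Real.sqrt T ≤ Real.sqrt T * (Real.sqrt T * |L|) := le_mul_of_one_le_right hR.le h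
        _ = T * |L| := by rw [← mul_assoc, Real.mul_self_sqrt hT.le]
    have h2 : Real.exp (σ * L) / (T * |L|) ≤ Real.exp (σ * L) / Real.sqrt T := by gcongr
    refine (norm_perronError_le_div hT hL hσ).trans (h2.trans ?_)
    nlinarith
  · have h1 := half_le_fejer hR h
    refine (norm_perronError_le hT hσ).trans ?_
    have h2 : Real.exp (σ * L) = Real.exp (σ * L) / Real.sqrt T * Real.sqrt T := by field_simp
    nlinarith

/-- Termwise integration of a uniformly dominated series of continuous functions. -/
theorem hasSum_intervalIntegral_of_norm_le {F : ℕ → ℝ → ℂ} {u : ℕ → ℝ} (a b : ℝ)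
    (hF : ∀ n, Continuous (F n)) (hu : Summable u) (hb : ∀ n t, ‖F n t‖ ≤ u n) :
    HasSum (fun n => ∫ t in a..b, F n t) (∫ t in a..b, ∑' n, F n t) := by
  refine intervalIntegral.hasSum_integral_of_dominated_convergence (fun n _ => u n)
    (fun n => (hF n).aestronglyMeasurable) (fun n => .of_forall fun t _ => hb n t)
    (.of_forall fun _ _ => hu) intervalIntegrable_const (.of_forall fun t _ => ?_)
  exact (Summable.of_norm_bounded hu fun n => hb n t).hasSum

theorem natCast_cpow_neg_mul_cpow {n : ℕ} (hn : n ≠ 0) {x : ℝ} (hx : 0 < x) (s : ℂ) :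
    (n : ℂ) ^ (-s) * (x : ℂ) ^ s =
      Complex.exp (s * ((Real.log x - Real.log n : ℝ) : ℂ)) := by
  rw [Complex.cpow_def_of_ne_zero (Nat.cast_ne_zero.2 hn),
    Complex.cpow_def_of_ne_zero (Complex.ofReal_ne_zero.2 hx.ne'), ← Complex.exp_add,
    ← Complex.ofReal_log hx.le, ← Complex.natCast_log]
  congr 1
  push_cast
  ring

theorem rpow_neg_mul_rpow {n : ℕ} (hn : n ≠ 0) {x : ℝ} (hx : 0 < x) (σ : ℝ) :
    (n : ℝ) ^ (-σ) * x ^ σ = Real.exp (σ * (Real.log x - Real.log n)) := by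
  rw [Real.rpow_def_of_pos (by positivity), Real.rpow_def_of_pos hx, ← Real.exp_add]
  congr 1
  ring

theorem cpow_neg_add_mul_cpow {n : ℕ} (hn : n ≠ 0) {x : ℝ} (hx : 0 < x) (σ τ : ℝ) :
    (x : ℂ) ^ (I * (τ : ℂ)) * (n : ℂ) ^ (-((σ : ℂ) + I * τ)) =
      (((n : ℝ) ^ (-σ) : ℝ) : ℂ) * Complex.exp (I * τ * ((Real.log x - Real.log n : ℝ) : ℂ)) := by
  have hn' : (n : ℂ) ≠ 0 := Nat.cast_ne_zero.2 hn
  rw [← natCast_cpow_neg_mul_cpow hn hx, neg_add, Complex.cpow_add _ _ hn',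
    Complex.ofReal_cpow (Nat.cast_nonneg n)]
  push_cast
  ring

theorem norm_mul_cpow_neg {a : ℕ → ℂ} (ha : a 0 = 0) (n : ℕ) (s : ℂ) :
    ‖a n * (n : ℂ) ^ (-s)‖ = ‖a n‖ * (n : ℝ) ^ (-s.re) := by
  rcases Nat.eq_zero_or_pos n with rfl | hn
  · simp [ha]
  · rw [norm_mul, Complex.norm_natCast_cpow_of_pos hn, Complex.neg_re]

/-- The Fejér-weighted integral of a Dirichlet series, expanded termwise. -/
theorem hasSum_fejer {a : ℕ → ℂ} (ha : a 0 = 0) {x σ R : ℝ} (hx : 0 < x) (hR : 0 < R)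
    (hsum : Summable fun n : ℕ => ‖a n‖ * (n : ℝ) ^ (-σ)) :
    HasSum (fun n : ℕ => ((‖a n‖ * (n : ℝ) ^ (-σ) * fejer R (Real.log x - Real.log n) : ℝ) : ℂ))
      (∫ τ in (-R)..R, (x : ℂ) ^ (I * (τ : ℂ)) *
        (∑' n : ℕ, ((‖a n‖ : ℝ) : ℂ) * (n : ℂ) ^ (-((σ : ℂ) + I * τ))) *
          ((Kker (τ / R) : ℝ) : ℂ)) := by
  have hterm : ∀ (n : ℕ) (τ : ℝ), (x : ℂ) ^ (I * (τ : ℂ)) *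
      (((‖a n‖ : ℝ) : ℂ) * (n : ℂ) ^ (-((σ : ℂ) + I * τ))) * ((Kker (τ / R) : ℝ) : ℂ) =
      ((‖a n‖ * (n : ℝ) ^ (-σ) : ℝ) : ℂ) *
        (Complex.exp (I * τ * ((Real.log x - Real.log n : ℝ) : ℂ)) * (Kker (τ / R) : ℂ)) := by
    intro n τ
    rcases Nat.eq_zero_or_pos n with rfl | hn
    · simp [ha]
    · rw [mul_left_comm, cpow_neg_add_mul_cpow hn.ne' hx, Complex.ofReal_mul]
      ring
  simp only [← tsum_mul_left, ← tsum_mul_right, hterm]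
  have hK := continuous_Kker
  refine (hasSum_intervalIntegral_of_norm_le (-R) R (fun n => by fun_prop) hsum
    fun n τ => ?_).congr_fun fun n => ?_
  · rw [norm_mul, norm_mul, Complex.norm_real, Complex.norm_real, Real.norm_of_nonneg
      (by positivity), Real.norm_of_nonneg (Kker_nonneg _),
      show I * (τ : ℂ) * ((Real.log x - Real.log n : ℝ) : ℂ) =
        ((τ * (Real.log x - Real.log n) : ℝ) : ℂ) * I by push_cast; ring,
      Complex.norm_exp_ofReal_mul_I, one_mul]
    exact mul_le_of_le_one_right (by positivity) (Kker_le_one _)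
  · rw [intervalIntegral.integral_const_mul, integral_exp_mul_Kker hR, ← Complex.ofReal_mul]

/-- The truncated Perron integral of a Dirichlet series, expanded termwise. -/
theorem hasSum_perronIntegral {a : ℕ → ℂ} (ha : a 0 = 0) {x σ : ℝ} (T : ℝ) (hx : 0 < x)
    (hσ : 0 < σ) (hsum : Summable fun n : ℕ => ‖a n‖ * (n : ℝ) ^ (-σ)) :
    HasSum (fun n : ℕ => a n * perronIntegral T (Real.log x - Real.log n) σ)
      (∫ t in (-T)..T, (∑' n : ℕ, a n * (n : ℂ) ^ (-((σ : ℂ) + I * t))) *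
        (x : ℂ) ^ ((σ : ℂ) + I * t) / ((σ : ℂ) + I * t)) := by
  have hterm : ∀ (n : ℕ) (t : ℝ), a n * (n : ℂ) ^ (-((σ : ℂ) + I * t)) *
      (x : ℂ) ^ ((σ : ℂ) + I * t) / ((σ : ℂ) + I * t) =
      a n * (Complex.exp (((σ : ℂ) + t * I) * ((Real.log x - Real.log n : ℝ) : ℂ)) /
        ((σ : ℂ) + t * I)) := by
    intro n t
    rcases Nat.eq_zero_or_pos n with rfl | hn
    · simp [ha]
    · rw [mul_assoc, natCast_cpow_neg_mul_cpow hn.ne' hx, mul_comm I, mul_div_assoc]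
  simp only [div_eq_mul_inv, ← tsum_mul_right] at hterm ⊢
  simp only [hterm, ← div_eq_mul_inv]
  have hcont : ∀ n : ℕ, Continuous fun t : ℝ =>
      a n * (Complex.exp (((σ : ℂ) + t * I) * ((Real.log x - Real.log n : ℝ) : ℂ)) /
        ((σ : ℂ) + t * I)) :=
    fun n => continuous_const.mul (Continuous.div_add_mul_I (by fun_prop) hσ.ne')
  refine (hasSum_intervalIntegral_of_norm_le (-T) T hcont (hsum.mul_right (x ^ σ / σ))
    fun n t => ?_).congr_fun fun n => ?_
  · rcases Nat.eq_zero_or_pos n with rfl | hn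
    · simp [ha]
    · rw [norm_mul, norm_div, norm_exp_add_mul_I_mul, mul_assoc, ← mul_div_assoc ((n : ℝ) ^ (-σ)),
        rpow_neg_mul_rpow hn.ne' hx]
      gcongr
      simpa [abs_of_pos hσ] using Complex.abs_re_le_norm ((σ : ℂ) + t * I)
  · rw [intervalIntegral.integral_const_mul, perronIntegral]

theorem hasSum_perronError {a : ℕ → ℂ} (ha : a 0 = 0) {x σ : ℝ} (T : ℝ) (hx : 0 < x)
    (hσ : 0 < σ) (hsum : Summable fun n : ℕ => ‖a n‖ * (n : ℝ) ^ (-σ)) :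
    HasSum (fun n : ℕ => a n * perronError T (Real.log x - Real.log n) σ)
      ((∑ n ∈ Finset.Icc 1 ⌊x⌋₊, a n) - (1 / (2 * (π : ℂ))) *
        ∫ t in (-T)..T, (∑' n : ℕ, a n * (n : ℂ) ^ (-((σ : ℂ) + I * t))) *
          (x : ℂ) ^ ((σ : ℂ) + I * t) / ((σ : ℂ) + I * t)) := by
  have h1 : HasSum (fun n => if n ∈ Finset.Icc 1 ⌊x⌋₊ then a n else 0)
      (∑ n ∈ Finset.Icc 1 ⌊x⌋₊, a n) := by
    have := hasSum_sum_of_ne_finset_zero (L := .unconditional ℕ)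
      (f := fun n => if n ∈ Finset.Icc 1 ⌊x⌋₊ then a n else 0) (s := Finset.Icc 1 ⌊x⌋₊) fun n hn => if_neg hn
    rwa [Finset.sum_congr rfl fun n hn => if_pos hn] at this
  refine (h1.sub ((hasSum_perronIntegral ha T hx hσ hsum).mul_left _)).congr_fun fun n => ?_
  rcases Nat.eq_zero_or_pos n with rfl | hn
  · simp [ha]
  · have hiff : n ∈ Finset.Icc 1 ⌊x⌋₊ ↔ 0 ≤ Real.log x - Real.log n := by
      rw [Finset.mem_Icc, Nat.le_floor_iff hx.le, sub_nonneg,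
        Real.log_le_log_iff (by positivity) hx]
      exact and_iff_right hn
    simp only [hiff, perronError]
    split_ifs <;> ring

/-- Lemma 2: a truncated Perron formula. -/
theorem stmt4 :
    ∃ C > (0 : ℝ), ∀ (a : ℕ → ℂ) (σ₀ : ℝ), 0 < σ₀ → a 0 = 0 →
      (∀ s : ℂ, σ₀ < s.re → Summable fun n : ℕ => ‖a n * (n : ℂ) ^ (-s)‖) →
      ∀ x σ T : ℝ, 2 ≤ x → σ₀ < σ → 2 ≤ T →
      ∀ J : ℂ,
        J = (∫ τ in (-Real.sqrt T)..(Real.sqrt T),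
              (x : ℂ) ^ (Complex.I * (τ : ℂ)) *
                (∑' n : ℕ, ((‖a n‖ : ℝ) : ℂ) * (n : ℂ) ^ (-((σ : ℂ) + Complex.I * τ))) *
                ((Kker (τ / Real.sqrt T) : ℝ) : ℂ)) →
        0 ≤ J.re ∧ J.im = 0 ∧
        ‖(∑ n ∈ Finset.Icc 1 ⌊x⌋₊, a n) -
            (1 / (2 * (Real.pi : ℂ))) *
              ∫ t in (-T)..T,
                (∑' n : ℕ, a n * (n : ℂ) ^ (-((σ : ℂ) + Complex.I * t))) *
                  (x : ℂ) ^ ((σ : ℂ) + Complex.I * t) / ((σ : ℂ) + Complex.I * t)‖ ≤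
          C * (x ^ σ / Real.sqrt T) *
            ((∑' n : ℕ, ‖a n‖ * (n : ℝ) ^ (-σ)) + J.re) := by
  refine ⟨6, by norm_num, fun a σ₀ hσ₀ ha hconv x σ T hx hσ hT J hJ => ?_⟩
  have hx0 : 0 < x := by linarith
  have hT0 : 0 < T := by linarith
  have hσ0 : 0 < σ := hσ₀.trans hσ
  have hR : 0 < Real.sqrt T := Real.sqrt_pos.2 hT0
  have hsum : Summable fun n : ℕ => ‖a n‖ * (n : ℝ) ^ (-σ) := by
    simpa only [norm_mul_cpow_neg ha, Complex.ofReal_re] using hconv (σ : ℂ) (by simpa using hσ)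
  have hJsum := hasSum_fejer ha hx0 hR hsum
  rw [← hJ] at hJsum
  have hre := Complex.hasSum_re hJsum
  have him := Complex.hasSum_im hJsum
  simp only [Complex.ofReal_re, Complex.ofReal_im] at hre him
  refine ⟨hre.nonneg fun n => mul_nonneg (by positivity) (fejer_nonneg hR _),
    him.unique hasSum_zero, ?_⟩
  have hbound := (hsum.hasSum.add hre).mul_left (6 * (x ^ σ / Real.sqrt T))
  have herr := hasSum_perronError ha T hx0 hσ0 hsum
  refine herr.norm_le_of_bounded hbound fun n => ?_
  rcases Nat.eq_zero_or_pos n with rfl | hn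
  · simp [ha]
  · rw [norm_mul]
    refine (mul_le_mul_of_nonneg_left (norm_perronError_le_fejer hT0 hσ0 _)
      (norm_nonneg _)).trans_eq ?_
    rw [← rpow_neg_mul_rpow hn.ne' hx0]
    ring

end
end

section
/- There exists a family of real numbers (d_{k,ℓ}) indexed by pairs of nonnegative integers (k,ℓ) with k+ℓ ≥ 1, with d_{k,ℓ} > 0 for all such (k,ℓ) and d_{1,0} = d_{0,1} = 1/2, such that for all (a,b) ∈ U², Ξ(a,b) = ∑_{k+ℓ ≥ 1} d_{k,ℓ} a^k b^ℓ, the double series converging absolutely on U². -/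
open Complex Finset MeasureTheory
open scoped Real Classical

noncomputable section

/-- The coefficient of `x ^ n` in the binomial series of `(1 - x) ^ (-t)`. -/
def risingCoeff (n : ℕ) (t : ℝ) : ℝ := ∏ i ∈ range n, (t + i) / (i + 1)

lemma risingCoeff_pos (n : ℕ) {t : ℝ} (ht : 0 < t) : 0 < risingCoeff n t :=
  prod_pos fun i _ => by positivity

lemma risingCoeff_nonneg (n : ℕ) {t : ℝ} (ht : 0 ≤ t) : 0 ≤ risingCoeff n t :=
  prod_nonneg fun i _ => by positivity

lemma risingCoeff_le_one (n : ℕ) {t : ℝ} (ht : 0 ≤ t) (ht' : t ≤ 1) : risingCoeff n t ≤ 1 :=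
  prod_le_one (fun i _ => by positivity) fun i _ => by
    rw [div_le_one (by positivity)]
    linarith

lemma continuous_risingCoeff (n : ℕ) : Continuous (risingCoeff n) := by
  unfold risingCoeff
  fun_prop

lemma multichoose_eq_risingCoeff (n : ℕ) (t : ℝ) : Ring.multichoose t n = risingCoeff n t := by
  have h := Ring.factorial_nsmul_multichoose_eq_ascPochhammer t n
  rw [Polynomial.ascPochhammer_smeval_eq_eval, nsmul_eq_mul] at h
  have hr : (n.factorial : ℝ) * risingCoeff n t = (ascPochhammer ℝ n).eval t := by
    clear h
    induction n with
    | zero => simp [risingCoeff]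
    | succ n ih =>
      rw [ascPochhammer_succ_eval, ← ih, risingCoeff, risingCoeff, prod_range_succ,
        Nat.factorial_succ]
      push_cast
      field_simp
  exact mul_left_cancel₀ (by positivity) (h.trans hr.symm)

lemma hasSum_risingCoeff (t : ℝ) {a : ℂ} (ha : ‖a‖ < 1) :
    HasSum (fun n => (risingCoeff n t : ℂ) * a ^ n) ((1 - a) ^ (-(t : ℂ))) := by
  have h := (one_div_one_sub_cpow_hasFPowerSeriesOnBall_zero (t : ℂ)).hasSum (y := a)
    (by simpa [enorm_eq_nnnorm, ← NNReal.coe_lt_coe] using ha)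
  convert! h using 1
  · ext n
    rw [← multichoose_eq_risingCoeff, Ring.multichoose_eq, ofReal_choose]
    simp [FormalMultilinearSeries.ofScalars, mul_comm]
  · simp [cpow_neg]

/-- The coefficient of `a ^ k * b ^ l` in `∫₀¹ (1 - a) ^ (t - 1) * (1 - b) ^ (-t) dt`. -/
def meanCoeff (k l : ℕ) : ℝ := ∫ t in (0 : ℝ)..1, risingCoeff k (1 - t) * risingCoeff l t

lemma continuous_risingCoeff_mul (k l : ℕ) :
    Continuous fun t => risingCoeff k (1 - t) * risingCoeff l t :=
  ((continuous_risingCoeff k).comp (by fun_prop)).mul (continuous_risingCoeff l)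

lemma meanCoeff_pos (k l : ℕ) : 0 < meanCoeff k l :=
  intervalIntegral.intervalIntegral_pos_of_pos_on
    ((continuous_risingCoeff_mul k l).intervalIntegrable _ _)
    (fun t ht => mul_pos (risingCoeff_pos k (by linarith [ht.2])) (risingCoeff_pos l ht.1))
    one_pos

lemma meanCoeff_le_one (k l : ℕ) : meanCoeff k l ≤ 1 := by
  have h : meanCoeff k l ≤ ∫ _ in (0 : ℝ)..1, (1 : ℝ) := by
    refine intervalIntegral.integral_mono_on zero_le_one
      ((continuous_risingCoeff_mul k l).intervalIntegrable _ _) (by simp) fun t ht => ?_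
    exact mul_le_one₀ (risingCoeff_le_one k (by linarith [ht.2]) (by linarith [ht.1]))
      (risingCoeff_nonneg l ht.1) (risingCoeff_le_one l ht.1 ht.2)
  simpa using h

lemma meanCoeff_zero_zero : meanCoeff 0 0 = 1 := by
  simp [meanCoeff, risingCoeff]

lemma meanCoeff_one_zero : meanCoeff 1 0 = 1 / 2 := by
  simp only [meanCoeff, risingCoeff, prod_range_one, prod_range_zero]
  rw [intervalIntegral.integral_congr (g := fun t : ℝ => 1 - t) fun t _ => by simp,
    intervalIntegral.integral_sub (by simp) (by simp)]
  norm_num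

lemma meanCoeff_zero_one : meanCoeff 0 1 = 1 / 2 := by
  simp [meanCoeff, risingCoeff]

lemma summable_norm_pow_mul_norm_pow {a b : ℂ} (ha : ‖a‖ < 1) (hb : ‖b‖ < 1) :
    Summable fun p : ℕ × ℕ => ‖a‖ ^ p.1 * ‖b‖ ^ p.2 :=
  (summable_geometric_of_lt_one (norm_nonneg a) ha).mul_of_nonneg
    (summable_geometric_of_lt_one (norm_nonneg b) hb)
    (fun _ => by positivity) (fun _ => by positivity)

lemma hasSum_meanCoeff {a b : ℂ} (ha : ‖a‖ < 1) (hb : ‖b‖ < 1) :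
    HasSum (fun p : ℕ × ℕ => (meanCoeff p.1 p.2 : ℂ) * a ^ p.1 * b ^ p.2)
      (∫ t in (0 : ℝ)..1, (1 - a) ^ (-((1 - t : ℝ) : ℂ)) * (1 - b) ^ (-(t : ℂ))) := by
  have h := intervalIntegral.hasSum_integral_of_dominated_convergence (μ := volume)
    (a := (0 : ℝ)) (b := 1)
    (F := fun (p : ℕ × ℕ) (t : ℝ) =>
      ((risingCoeff p.1 (1 - t) : ℂ) * a ^ p.1) * ((risingCoeff p.2 t : ℂ) * b ^ p.2))
    (f := fun t : ℝ => (1 - a) ^ (-((1 - t : ℝ) : ℂ)) * (1 - b) ^ (-(t : ℂ)))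
    (fun p _ => ‖a‖ ^ p.1 * ‖b‖ ^ p.2) ?_ ?_ ?_ ?_ ?_
  · convert! h using 2 with p
    rw [meanCoeff, ← intervalIntegral.integral_ofReal, mul_assoc,
      ← intervalIntegral.integral_mul_const]
    congr 1
    ext t
    push_cast
    ring
  · intro p
    refine Continuous.aestronglyMeasurable ?_
    exact ((continuous_ofReal.comp ((continuous_risingCoeff p.1).comp (by fun_prop))).mul_const
      _).mul ((continuous_ofReal.comp (continuous_risingCoeff p.2)).mul_const _)
  · refine fun p => Filter.Eventually.of_forall fun t ht => ?_
    rw [Set.uIoc_of_le zero_le_one] at ht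
    have h1 := risingCoeff_nonneg p.1 (t := 1 - t) (by linarith [ht.2])
    have h2 := risingCoeff_nonneg p.2 ht.1.le
    rw [norm_mul, norm_mul, norm_mul, norm_pow, norm_pow, norm_real, norm_real,
      Real.norm_of_nonneg h1, Real.norm_of_nonneg h2]
    gcongr
    · exact mul_le_of_le_one_left (by positivity)
        (risingCoeff_le_one p.1 (by linarith [ht.2]) (by linarith [ht.1]))
    · exact mul_le_of_le_one_left (by positivity) (risingCoeff_le_one p.2 ht.1.le ht.2)
  · exact Filter.Eventually.of_forall fun t _ => summable_norm_pow_mul_norm_pow ha hb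
  · simp
  · refine Filter.Eventually.of_forall fun t ht => ?_
    rw [Set.uIoc_of_le zero_le_one] at ht
    have hA := hasSum_risingCoeff (1 - t) ha
    have hB := hasSum_risingCoeff t hb
    have hAB := summable_mul_of_summable_norm hA.summable.norm hB.summable.norm
    rw [← hA.tsum_eq, ← hB.tsum_eq,
      tsum_mul_tsum_of_summable_norm hA.summable.norm hB.summable.norm]
    exact hAB.hasSum

lemma one_sub_mem_slitPlane {a : ℂ} (ha : ‖a‖ < 1) : 1 - a ∈ slitPlane := by
  simpa [sub_eq_add_neg] using mem_slitPlane_of_norm_lt_one (z := -a) (by simpa using ha)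

lemma abs_log_one_sub_im_lt {a : ℂ} (ha : ‖a‖ < 1) : |(log (1 - a)).im| < π / 2 := by
  rw [log_im, abs_arg_lt_pi_div_two_iff]
  left
  have := (re_le_norm a).trans_lt ha
  simp only [sub_re, one_re]
  linarith

lemma abs_log_sub_log_im_lt {a b : ℂ} (ha : ‖a‖ < 1) (hb : ‖b‖ < 1) :
    |(log (1 - a) - log (1 - b)).im| < π := by
  have h1 := abs_lt.1 (abs_log_one_sub_im_lt ha)
  have h2 := abs_lt.1 (abs_log_one_sub_im_lt hb)
  rw [sub_im, abs_lt]
  constructor <;> linarith [h1.1, h1.2, h2.1, h2.2]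

lemma exp_log_sub_log {a b : ℂ} (ha : ‖a‖ < 1) (hb : ‖b‖ < 1) :
    exp (log (1 - a) - log (1 - b)) = (1 - a) / (1 - b) := by
  rw [exp_sub, exp_log (slitPlane_ne_zero (one_sub_mem_slitPlane ha)),
    exp_log (slitPlane_ne_zero (one_sub_mem_slitPlane hb))]

lemma log_one_sub_div_one_sub {a b : ℂ} (ha : ‖a‖ < 1) (hb : ‖b‖ < 1) :
    log ((1 - a) / (1 - b)) = log (1 - a) - log (1 - b) := by
  have h := abs_lt.1 (abs_log_sub_log_im_lt ha hb)
  rw [← exp_log_sub_log ha hb, log_exp h.1 h.2.le]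

lemma log_one_sub_sub_ne_zero {a b : ℂ} (ha : ‖a‖ < 1) (hb : ‖b‖ < 1) (hab : a ≠ b) :
    log (1 - a) - log (1 - b) ≠ 0 := by
  intro h
  have h' := exp_log_sub_log ha hb
  rw [h, exp_zero, eq_comm, div_eq_one_iff_eq (slitPlane_ne_zero (one_sub_mem_slitPlane hb))] at h'
  exact hab (sub_right_injective h')

/-- The integrand interpolates geometrically between `1 / A` and `1 / B`, so the integral is
`1 / (A * B)` times the logarithmic mean of `A` and `B`. -/
lemma integral_cpow_mul_cpow {A B : ℂ} (hA : A ≠ 0) (hB : B ≠ 0) (h : log A - log B ≠ 0) :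
    ∫ t in (0 : ℝ)..1, A ^ (-((1 - t : ℝ) : ℂ)) * B ^ (-(t : ℂ)) =
      (A - B) / (A * B * (log A - log B)) := by
  have hint : ∀ t : ℝ, A ^ (-((1 - t : ℝ) : ℂ)) * B ^ (-(t : ℂ)) =
      A⁻¹ * exp ((log A - log B) * t) := by
    intro t
    rw [cpow_def_of_ne_zero hA, cpow_def_of_ne_zero hB, ← exp_add,
      show log A * -((1 - t : ℝ) : ℂ) + log B * -(t : ℂ) = (log A - log B) * t - log A by
        push_cast; ring, exp_sub, exp_log hA, div_eq_inv_mul]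
  simp_rw [hint]
  rw [intervalIntegral.integral_const_mul, integral_exp_mul_complex h]
  simp only [ofReal_one, mul_one, ofReal_zero, mul_zero, exp_zero, exp_sub, exp_log hA, exp_log hB]
  field_simp

lemma integral_cpow_mul_cpow_self {A : ℂ} (hA : A ≠ 0) :
    ∫ t in (0 : ℝ)..1, A ^ (-((1 - t : ℝ) : ℂ)) * A ^ (-(t : ℂ)) = A⁻¹ := by
  have hint : ∀ t : ℝ, A ^ (-((1 - t : ℝ) : ℂ)) * A ^ (-(t : ℂ)) = A⁻¹ := by
    intro t
    rw [← cpow_add _ _ hA, show -((1 - t : ℝ) : ℂ) + -(t : ℂ) = -1 by push_cast; ring,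
      cpow_neg_one]
  simp_rw [hint]
  simp

lemma exp_sub_exp_neg_div_re_pos {w : ℂ} (hw : w ≠ 0) (him : |w.im| < π) :
    0 < ((exp (w / 2) - exp (-(w / 2))) / w).re := by
  have him' := abs_lt.1 him
  have hn : 0 < normSq w := normSq_pos.2 hw
  have key : 0 < w.re * (Real.sinh (w.re / 2) * Real.cos (w.im / 2)) +
      w.im * (Real.cosh (w.re / 2) * Real.sin (w.im / 2)) := by
    have hcos : 0 < Real.cos (w.im / 2) :=
      Real.cos_pos_of_mem_Ioo ⟨by linarith [him'.1], by linarith [him'.2]⟩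
    have hx : w.re ≠ 0 → 0 < w.re * Real.sinh (w.re / 2) := fun h => by
      rcases lt_or_gt_of_ne h with h | h
      · exact mul_pos_of_neg_of_neg h (Real.sinh_neg_iff.2 (by linarith))
      · exact mul_pos h (Real.sinh_pos_iff.2 (by linarith))
    have hy : w.im ≠ 0 → 0 < w.im * Real.sin (w.im / 2) := fun h => by
      rcases lt_or_gt_of_ne h with h | h
      · exact mul_pos_of_neg_of_neg h
          (Real.sin_neg_of_neg_of_neg_pi_lt (by linarith) (by linarith [him'.1, Real.pi_pos]))
      · exact mul_pos h (Real.sin_pos_of_pos_of_lt_pi (by linarith)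
          (by linarith [him'.2, Real.pi_pos]))
    have hcosh := Real.cosh_pos (w.re / 2)
    have hx' : 0 ≤ w.re * Real.sinh (w.re / 2) := by
      by_cases h : w.re = 0
      · simp [h]
      · exact (hx h).le
    by_cases h : w.im = 0
    · have hre : w.re ≠ 0 := fun h' => hw (Complex.ext h' h)
      simpa [h] using hx hre
    · nlinarith [mul_pos (hy h) hcosh, mul_nonneg hx' hcos.le]
  have h2re : (w / 2).re = w.re / 2 := by simp
  have h2im : (w / 2).im = w.im / 2 := by simp
  rw [div_re, ← add_div]
  refine div_pos ?_ hn
  simp only [sub_re, sub_im, exp_re, exp_im, neg_re, neg_im, h2re, h2im, Real.cos_neg, Real.sin_neg]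
  rw [Real.sinh_eq, Real.cosh_eq] at key
  linarith

lemma exp_sub_exp_neg_div_mem_slitPlane {w : ℂ} (hw : w ≠ 0) (him : |w.im| < π) :
    (exp (w / 2) - exp (-(w / 2))) / w ∈ slitPlane :=
  Or.inl (exp_sub_exp_neg_div_re_pos hw him)

lemma gfun_of_ne_one {z : ℂ} (hz : z ≠ 0) (hz' : z ≠ 1) :
    gfun z = log ((exp (log z / 2) - exp (-(log z / 2))) / log z) := by
  rw [gfun, if_neg hz', cpow_def_of_ne_zero hz, cpow_def_of_ne_zero hz, mul_neg,
    div_eq_mul_inv (log z) 2]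

lemma tendsto_exp_sub_exp_neg_div :
    Filter.Tendsto (fun w : ℂ => (exp (w / 2) - exp (-(w / 2))) / w)
      (nhdsWithin 0 {0}ᶜ) (nhds 1) := by
  have h : HasDerivAt (fun w : ℂ => exp (w / 2) - exp (-(w / 2))) 1 0 := by
    have h2 := (hasDerivAt_id (0 : ℂ)).div_const 2
    convert! h2.cexp.sub h2.neg.cexp using 1
    norm_num
  have h' := h.tendsto_slope_zero
  refine h'.congr fun w => ?_
  simp [div_eq_inv_mul]

lemma continuousAt_gfun_one : ContinuousAt gfun 1 := by
  rw [continuousAt_iff_punctured_nhds]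
  have hlog : Filter.Tendsto log (nhdsWithin 1 {1}ᶜ) (nhdsWithin 0 {0}ᶜ) := by
    refine tendsto_nhdsWithin_iff.2 ⟨?_, ?_⟩
    · have h : ContinuousAt log 1 := continuousAt_clog one_mem_slitPlane
      simpa [ContinuousAt] using h.tendsto.mono_left nhdsWithin_le_nhds
    · filter_upwards [self_mem_nhdsWithin,
        nhdsWithin_le_nhds (isOpen_ne.mem_nhds (one_ne_zero (α := ℂ)))] with z hz hz0 h
      exact hz (by simpa [exp_log hz0] using congrArg exp h)
  have h := (continuousAt_clog one_mem_slitPlane).tendsto.comp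
    (tendsto_exp_sub_exp_neg_div.comp hlog)
  rw [log_one] at h
  rw [show gfun 1 = 0 by simp [gfun]]
  refine h.congr' ?_
  filter_upwards [self_mem_nhdsWithin,
    nhdsWithin_le_nhds (isOpen_ne.mem_nhds (one_ne_zero (α := ℂ)))] with z hz hz0
  rw [gfun_of_ne_one hz0 hz]
  rfl

lemma Xi_self {a : ℂ} (ha : ‖a‖ < 1) : Xi a a = -log (1 - a) := by
  rw [Xi, div_self (slitPlane_ne_zero (one_sub_mem_slitPlane ha)), gfun, if_pos rfl]
  ring

lemma Xi_of_ne {a b : ℂ} (ha : ‖a‖ < 1) (hb : ‖b‖ < 1) (hab : a ≠ b) :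
    Xi a b = -(2⁻¹ : ℂ) * log (1 - a) - (2⁻¹ : ℂ) * log (1 - b) -
      log ((exp ((log (1 - a) - log (1 - b)) / 2) - exp (-((log (1 - a) - log (1 - b)) / 2))) /
        (log (1 - a) - log (1 - b))) := by
  have hA := slitPlane_ne_zero (one_sub_mem_slitPlane ha)
  have hB := slitPlane_ne_zero (one_sub_mem_slitPlane hb)
  rw [Xi, gfun_of_ne_one (div_ne_zero hA hB), log_one_sub_div_one_sub ha hb]
  rw [Ne, div_eq_one_iff_eq hB]
  exact fun h => hab (sub_right_injective h)

lemma norm_ofReal_mul_lt_one {a : ℂ} (ha : ‖a‖ < 1) {s : ℝ} (hs : s ∈ Set.Icc (0 : ℝ) 1) :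
    ‖(s : ℂ) * a‖ < 1 := by
  rw [norm_mul, norm_real, Real.norm_of_nonneg hs.1]
  exact (mul_le_of_le_one_left (norm_nonneg a) hs.2).trans_lt ha

lemma hasDerivAt_log_one_sub_mul {a : ℂ} {s : ℝ} (ha : ‖(s : ℂ) * a‖ < 1) :
    HasDerivAt (fun x : ℝ => log (1 - (x : ℂ) * a)) (-a / (1 - s * a)) s := by
  have h : HasDerivAt (fun x : ℝ => 1 - (x : ℂ) * a) (-a) s := by
    simpa using ((hasDerivAt_id s).ofReal_comp.mul_const a).const_sub 1
  exact h.clog_real (one_sub_mem_slitPlane ha)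

/-- The algebra behind the derivative of `Ξ` along a ray: `w` stands for the difference of the
logarithms of `1 - s * a` and `1 - s * b`, and `u`, `v` for `exp (± w / 2)`. -/
lemma euler_ray_identity {a b s w u v : ℂ} (hs : s ≠ 0) (hA : 1 - s * a ≠ 0) (hB : 1 - s * b ≠ 0)
    (hw : w ≠ 0) (hab : s * a ≠ s * b) (huv : u - v ≠ 0) (hmul : u * v = 1)
    (hsq : u ^ 2 * (1 - s * b) = 1 - s * a) :
    ((1 - s * a - (1 - s * b)) / ((1 - s * a) * (1 - s * b) * w) - 1) / s =
      -2⁻¹ * (-a / (1 - s * a)) - 2⁻¹ * (-b / (1 - s * b)) -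
        ((u * ((-a / (1 - s * a) - -b / (1 - s * b)) / 2) -
            v * -((-a / (1 - s * a) - -b / (1 - s * b)) / 2)) * w -
          (u - v) * (-a / (1 - s * a) - -b / (1 - s * b))) / w ^ 2 / ((u - v) / w) := by
  have hu : u ≠ 0 := left_ne_zero_of_mul_eq_one hmul
  have hAB : (1 - s * a) - (1 - s * b) ≠ 0 := fun h => hab (by linear_combination -h)
  have hcoth : (u + v) / (u - v) = ((1 - s * a) + (1 - s * b)) / ((1 - s * a) - (1 - s * b)) := by
    rw [div_eq_div_iff huv hAB]
    refine mul_left_cancel₀ hu ?_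
    linear_combination (-2) * hsq + 2 * (1 - s * a) * hmul
  have hquot : ∀ d : ℂ, ((u * (d / 2) - v * -(d / 2)) * w - (u - v) * d) / w ^ 2 / ((u - v) / w) =
      ((u + v) / (u - v) / 2 - 1 / w) * d := by
    intro d
    field_simp
    ring
  rw [hquot, hcoth]
  obtain ⟨A, hAdef⟩ : ∃ A, A = 1 - s * a := ⟨_, rfl⟩
  obtain ⟨B, hBdef⟩ : ∃ B, B = 1 - s * b := ⟨_, rfl⟩
  have ha : a = (1 - A) / s := by rw [hAdef]; field_simp; ring
  have hb : b = (1 - B) / s := by rw [hBdef]; field_simp; ring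
  rw [← hAdef, ← hBdef] at hAB ⊢
  rw [← hAdef] at hA
  rw [← hBdef] at hB
  rw [ha, hb]
  field_simp
  ring

/-- The derivative of `Ξ` along rays. -/
lemma hasDerivAt_Xi_ray {a b : ℂ} {s : ℝ} (hs : 0 < s) (ha : ‖(s : ℂ) * a‖ < 1)
    (hb : ‖(s : ℂ) * b‖ < 1) :
    HasDerivAt (fun x : ℝ => Xi (x * a) (x * b))
      (((∫ t in (0 : ℝ)..1, (1 - s * a) ^ (-((1 - t : ℝ) : ℂ)) * (1 - s * b) ^ (-(t : ℂ))) - 1)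
        / s) s := by
  have hs' : (s : ℂ) ≠ 0 := ofReal_ne_zero.2 hs.ne'
  have hA := slitPlane_ne_zero (one_sub_mem_slitPlane ha)
  have hB := slitPlane_ne_zero (one_sub_mem_slitPlane hb)
  have hnear : ∀ c : ℂ, ‖(s : ℂ) * c‖ < 1 → ∀ᶠ x : ℝ in nhds s, ‖(x : ℂ) * c‖ < 1 := fun c hc =>
    ContinuousAt.eventually_lt (f := fun x : ℝ => ‖(x : ℂ) * c‖) (by fun_prop)
      continuousAt_const hc
  rcases eq_or_ne a b with rfl | hab
  · rw [integral_cpow_mul_cpow_self hA]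
    have h := (hasDerivAt_log_one_sub_mul ha).neg
    convert! h.congr_of_eventuallyEq ?_ using 1
    · field_simp
      ring
    · filter_upwards [hnear a ha] with x hx using Xi_self hx
  · have hsab : (s : ℂ) * a ≠ s * b := fun h => hab (mul_left_cancel₀ hs' h)
    have hw := log_one_sub_sub_ne_zero ha hb hsab
    rw [integral_cpow_mul_cpow hA hB hw]
    have hE := exp_log_sub_log ha hb
    have hslit := exp_sub_exp_neg_div_mem_slitPlane hw (abs_log_sub_log_im_lt ha hb)
    have hdA := hasDerivAt_log_one_sub_mul ha
    have hdB := hasDerivAt_log_one_sub_mul hb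
    have hdw := hdA.sub hdB
    have hdh := hdw.div_const 2
    have h := ((hdA.const_mul (-(2⁻¹ : ℂ))).sub (hdB.const_mul (2⁻¹ : ℂ))).sub
      (((hdh.cexp.sub hdh.neg.cexp).div hdw hw).clog_real hslit)
    convert! h.congr_of_eventuallyEq ?_ using 1
    · have hne := slitPlane_ne_zero hslit
      simp only [Pi.sub_apply, Pi.neg_apply, Pi.div_apply] at hne hE ⊢
      refine euler_ray_identity hs' hA hB hw hsab (div_ne_zero_iff.1 hne).1 ?_ ?_
      · rw [← exp_add, add_neg_cancel, exp_zero]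
      · rw [← exp_nat_mul, Nat.cast_ofNat, mul_div_cancel₀ _ two_ne_zero, hE,
          div_mul_cancel₀ _ hB]
    · filter_upwards [hnear a ha, hnear b hb, lt_mem_nhds hs] with x hxa hxb hx
      exact Xi_of_ne hxa hxb fun h => hab (mul_left_cancel₀ (ofReal_ne_zero.2 hx.ne') h)

/-- The coefficient of `a ^ k * b ^ l` in `Ξ`. -/
def xiCoeff (k l : ℕ) : ℝ := meanCoeff k l / (k + l : ℕ)

lemma xiCoeff_nonneg (k l : ℕ) : 0 ≤ xiCoeff k l :=
  div_nonneg (meanCoeff_pos k l).le (Nat.cast_nonneg _)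

lemma xiCoeff_mul_le_one (k l : ℕ) : xiCoeff k l * (k + l : ℕ) ≤ 1 := by
  rcases eq_or_ne ((k + l : ℕ) : ℝ) 0 with h | h
  · simp [h]
  · rw [xiCoeff, div_mul_cancel₀ _ h]
    exact meanCoeff_le_one k l

lemma xiCoeff_le_one (k l : ℕ) : xiCoeff k l ≤ 1 := by
  rcases Nat.eq_zero_or_pos (k + l) with h | h
  · simp [xiCoeff, h]
  · have h1 : (1 : ℝ) ≤ (k + l : ℕ) := by exact_mod_cast h
    exact (le_mul_of_one_le_right (xiCoeff_nonneg k l) h1).trans (xiCoeff_mul_le_one k l)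

lemma norm_xiCoeff_term_le (a b : ℂ) (p : ℕ × ℕ) :
    ‖(xiCoeff p.1 p.2 : ℂ) * a ^ p.1 * b ^ p.2‖ ≤ ‖a‖ ^ p.1 * ‖b‖ ^ p.2 := by
  rw [mul_assoc, norm_mul, norm_mul, norm_pow, norm_pow, norm_real,
    Real.norm_of_nonneg (xiCoeff_nonneg _ _)]
  exact mul_le_of_le_one_left (by positivity) (xiCoeff_le_one _ _)

lemma summable_norm_xiCoeff {a b : ℂ} (ha : ‖a‖ < 1) (hb : ‖b‖ < 1) :
    Summable fun p : ℕ × ℕ => ‖(xiCoeff p.1 p.2 : ℂ) * a ^ p.1 * b ^ p.2‖ :=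
  (summable_norm_pow_mul_norm_pow ha hb).of_nonneg_of_le (fun _ => norm_nonneg _)
    (norm_xiCoeff_term_le a b)

lemma norm_ofReal_mul_le (a : ℂ) {s : ℝ} (hs : s ∈ Set.Icc (0 : ℝ) 1) : ‖(s : ℂ) * a‖ ≤ ‖a‖ := by
  rw [norm_mul, norm_real, Real.norm_of_nonneg hs.1]
  exact mul_le_of_le_one_left (norm_nonneg a) hs.2

lemma continuousOn_xiCoeff_ray {a b : ℂ} (ha : ‖a‖ < 1) (hb : ‖b‖ < 1) :
    ContinuousOn (fun x : ℝ => ∑' p : ℕ × ℕ,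
      (xiCoeff p.1 p.2 : ℂ) * ((x : ℂ) * a) ^ p.1 * ((x : ℂ) * b) ^ p.2) (Set.Icc 0 1) := by
  refine continuousOn_tsum (fun p => by fun_prop) (summable_norm_pow_mul_norm_pow ha hb)
    fun p x hx => (norm_xiCoeff_term_le _ _ p).trans ?_
  gcongr <;> exact norm_ofReal_mul_le _ hx

lemma hasDerivAt_xiCoeff_ray {a b : ℂ} (ha : ‖a‖ < 1) (hb : ‖b‖ < 1) {s : ℝ}
    (hs : s ∈ Set.Ioo (0 : ℝ) 1) :
    HasDerivAt (fun x : ℝ => ∑' p : ℕ × ℕ,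
        (xiCoeff p.1 p.2 : ℂ) * ((x : ℂ) * a) ^ p.1 * ((x : ℂ) * b) ^ p.2)
      (((∫ t in (0 : ℝ)..1, (1 - s * a) ^ (-((1 - t : ℝ) : ℂ)) * (1 - s * b) ^ (-(t : ℂ))) - 1)
        / s) s := by
  have hs' : (s : ℂ) ≠ 0 := ofReal_ne_zero.2 hs.1.ne'
  have hterm : ∀ (p : ℕ × ℕ) (x : ℝ), HasDerivAt
      (fun x : ℝ => (xiCoeff p.1 p.2 : ℂ) * ((x : ℂ) * a) ^ p.1 * ((x : ℂ) * b) ^ p.2)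
      ((xiCoeff p.1 p.2 * (p.1 + p.2 : ℕ) : ℝ) * (x : ℂ) ^ (p.1 + p.2 - 1) *
        (a ^ p.1 * b ^ p.2)) x := by
    intro p x
    have h := ((((hasDerivAt_id x).ofReal_comp).pow (p.1 + p.2)).const_mul
      (xiCoeff p.1 p.2 : ℂ)).mul_const (a ^ p.1 * b ^ p.2)
    convert! h using 1
    · ext y
      simp only [Pi.pow_apply, id]
      ring
    · push_cast
      simp only [id, mul_one]
      ring
  have hsum := hasDerivAt_tsum_of_isPreconnected
    (summable_norm_pow_mul_norm_pow ha hb) isOpen_Ioo isPreconnected_Ioo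
    (fun p x _ => hterm p x) ?_ hs
    ((summable_norm_xiCoeff (norm_ofReal_mul_lt_one ha (Set.Ioo_subset_Icc_self hs))
      (norm_ofReal_mul_lt_one hb (Set.Ioo_subset_Icc_self hs))).of_norm) hs
  · convert! hsum using 1
    have hmean := hasSum_meanCoeff (norm_ofReal_mul_lt_one ha (Set.Ioo_subset_Icc_self hs))
      (norm_ofReal_mul_lt_one hb (Set.Ioo_subset_Icc_self hs))
    have hdiv := (hmean.sub (hasSum_ite_eq ((0, 0) : ℕ × ℕ) (1 : ℂ))).div_const (s : ℂ)
    rw [← hdiv.tsum_eq]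
    refine tsum_congr fun ⟨k, l⟩ => ?_
    rcases Nat.eq_zero_or_pos (k + l) with h | h
    · obtain ⟨rfl, rfl⟩ := Nat.add_eq_zero_iff.1 h
      simp [meanCoeff_zero_zero]
    · have hne : ((k, l) : ℕ × ℕ) ≠ (0, 0) := by
        rintro ⟨⟩
        exact h.false
      have hkl : ((k + l : ℕ) : ℝ) ≠ 0 := by positivity
      obtain ⟨n, hn⟩ : ∃ n, k + l = n + 1 := ⟨k + l - 1, by omega⟩
      rw [if_neg hne, sub_zero, xiCoeff, div_mul_cancel₀ _ hkl, div_eq_iff hs', hn,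
        Nat.add_sub_cancel, mul_pow, mul_pow]
      have hpow : (s : ℂ) ^ k * s ^ l = s ^ n * s := by rw [← pow_add, hn, pow_succ]
      linear_combination (meanCoeff k l : ℂ) * a ^ k * b ^ l * hpow
  · intro p x hx
    rw [norm_mul, norm_mul, norm_mul, norm_pow, norm_pow, norm_pow, norm_real, norm_real,
      Real.norm_of_nonneg (mul_nonneg (xiCoeff_nonneg _ _) (Nat.cast_nonneg _)),
      Real.norm_of_nonneg hx.1.le]
    exact mul_le_of_le_one_left (by positivity)
      (mul_le_one₀ (xiCoeff_mul_le_one _ _) (by have := hx.1; positivity)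
        (pow_le_one₀ hx.1.le hx.2.le))

lemma continuousOn_Xi_ray {a b : ℂ} (ha : ‖a‖ < 1) (hb : ‖b‖ < 1) :
    ContinuousOn (fun x : ℝ => Xi (x * a) (x * b)) (Set.Icc 0 1) := by
  intro s hs
  refine ContinuousAt.continuousWithinAt ?_
  rcases hs.1.eq_or_lt with rfl | hpos
  · have hg : ContinuousAt gfun ((1 - ((0 : ℝ) : ℂ) * a) / (1 - ((0 : ℝ) : ℂ) * b)) := by
      simpa using continuousAt_gfun_one
    have hz : ContinuousAt (fun x : ℝ => (1 - (x : ℂ) * a) / (1 - (x : ℂ) * b)) 0 :=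
      ContinuousAt.div (by fun_prop) (by fun_prop) (by simp)
    have hlog : ∀ c : ℂ, ContinuousAt (fun x : ℝ => log (1 - (x : ℂ) * c)) 0 := fun c =>
      (hasDerivAt_log_one_sub_mul (a := c) (by simp)).continuousAt
    exact (((hlog a).const_mul _).sub ((hlog b).const_mul _)).sub
      (ContinuousAt.comp (f := fun x : ℝ => (1 - (x : ℂ) * a) / (1 - (x : ℂ) * b)) hg hz)
  · exact (hasDerivAt_Xi_ray hpos (norm_ofReal_mul_lt_one ha hs)
      (norm_ofReal_mul_lt_one hb hs)).continuousAt

lemma hasSum_xiCoeff {a b : ℂ} (ha : ‖a‖ < 1) (hb : ‖b‖ < 1) :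
    HasSum (fun p : ℕ × ℕ => (xiCoeff p.1 p.2 : ℂ) * a ^ p.1 * b ^ p.2) (Xi a b) := by
  have hconst := intervalIntegral.integral_eq_sub_of_hasDerivAt_of_le zero_le_one
    ((continuousOn_Xi_ray ha hb).sub (continuousOn_xiCoeff_ray ha hb)) (f' := fun _ => 0)
    (fun s hs => by
      have hs' := Set.Ioo_subset_Icc_self hs
      have h := (hasDerivAt_Xi_ray hs.1 (norm_ofReal_mul_lt_one ha hs')
        (norm_ofReal_mul_lt_one hb hs')).sub (hasDerivAt_xiCoeff_ray ha hb hs)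
      rwa [sub_self] at h)
    (by simp)
  have hzero : ∑' p : ℕ × ℕ, (xiCoeff p.1 p.2 : ℂ) * (0 : ℂ) ^ p.1 * (0 : ℂ) ^ p.2 = 0 := by
    rw [tsum_eq_single (0, 0)]
    · simp [xiCoeff]
    · rintro ⟨_ | k, _ | l⟩ h
      · exact absurd rfl h
      all_goals simp
  have hXi : Xi 0 0 = 0 := by rw [Xi_self (by simp)]; simp
  simp only [intervalIntegral.integral_zero, Pi.sub_apply, ofReal_one, one_mul, ofReal_zero,
    zero_mul, hzero, hXi, sub_zero] at hconst
  rw [sub_eq_zero.1 hconst.symm]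
  exact (summable_norm_xiCoeff ha hb).of_norm.hasSum

/-- Lemma 3.(i): the power series expansion of `Ξ` on `U²` with
positive coefficients `d_{k,ℓ}` (for `k+ℓ ≥ 1`), `d_{1,0} = d_{0,1} = 1/2`. -/
theorem stmt5 :
    ∃ d : ℕ → ℕ → ℝ,
      d 0 0 = 0 ∧
      (∀ k l : ℕ, 1 ≤ k + l → 0 < d k l) ∧
      d 1 0 = 1 / 2 ∧ d 0 1 = 1 / 2 ∧
      ∀ a b : ℂ, ‖a‖ < 1 → ‖b‖ < 1 →
        Summable (fun p : ℕ × ℕ => ‖((d p.1 p.2 : ℝ) : ℂ) * a ^ p.1 * b ^ p.2‖) ∧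
        HasSum (fun p : ℕ × ℕ => ((d p.1 p.2 : ℝ) : ℂ) * a ^ p.1 * b ^ p.2) (Xi a b) := by
  refine ⟨xiCoeff, by simp [xiCoeff], fun k l h => ?_, ?_, ?_, fun a b ha hb =>
    ⟨summable_norm_xiCoeff ha hb, hasSum_xiCoeff ha hb⟩⟩
  · exact div_pos (meanCoeff_pos k l) (by exact_mod_cast h)
  · simp [xiCoeff, meanCoeff_one_zero]
  · simp [xiCoeff, meanCoeff_zero_one]

end
end
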